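/- arXiv:1106.2854 — 2 statements merged into one kernel-verified Lean document; each statement's English description precedes it below -/
import Mathlib

section
/- Let E ⊆ ℤ be a set of integers with positive upper Banach density. Then there exists a probability space (Y, 𝓑, μ), a bimeasurable bijection T : Y → Y that preserves μ (i.e., μ(T⁻¹(A)) = μ(A) for all A ∈ 𝓑), and a set A ∈ 𝓑 with μ(A) equal to the upper Banach density of E, such that for every finite set of integers U, the upper Banach density of ⋂_{i∈U} (E − i) is at least μ(⋂_{i∈U} T^{-i}(A)). -/
open MeasureTheory

open Classical in
/-- The upper Banach density of a set of integers: the infimum over `N ≥ 1` of the supremum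
of `|E ∩ [n,m]| / (m - n)` over all integer intervals `[n,m]` with `m - n ≥ N`. -/
noncomputable def upperBanachDensity (E : Set ℤ) : ℝ :=
  ⨅ N : {N : ℕ // 1 ≤ N}, ⨆ p : {p : ℤ × ℤ // (N.1 : ℤ) ≤ p.2 - p.1},
    (((Finset.Icc p.1.1 p.1.2).filter (fun x => x ∈ E)).card : ℝ) / ((p.1.2 - p.1.1 : ℤ) : ℝ)

open Filter Topology

open Classical in
/-- The proportion of points of the integer interval `[n, m]` that belong to `F`. -/
noncomputable def windowFreq (F : Set ℤ) (n m : ℤ) : ℝ :=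
  (((Finset.Icc n m).filter (fun x => x ∈ F)).card : ℝ) / ((Finset.Icc n m).card : ℝ)

theorem Int.cast_card_Icc_of_le {n m : ℤ} (h : n ≤ m) :
    ((Finset.Icc n m).card : ℝ) = ((m - n : ℤ) : ℝ) + 1 := by
  have h' : ((Finset.Icc n m).card : ℤ) = m - n + 1 := by
    rw [Int.card_Icc, Int.toNat_of_nonneg (by lia)]
    ring
  exact_mod_cast h'

open Classical in
theorem card_filter_Icc_le (F : Set ℤ) {n m : ℤ} (h : n ≤ m) :
    (((Finset.Icc n m).filter (fun x => x ∈ F)).card : ℝ) ≤ ((m - n : ℤ) : ℝ) + 1 := by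
  rw [← Int.cast_card_Icc_of_le h]
  exact_mod_cast Finset.card_filter_le _ _

open Classical in
theorem bddAbove_upperBanachDensity_ratio (F : Set ℤ) {N : ℕ} (hN : 1 ≤ N) :
    BddAbove (Set.range fun p : {p : ℤ × ℤ // (N : ℤ) ≤ p.2 - p.1} =>
      (((Finset.Icc p.1.1 p.1.2).filter (fun x => x ∈ F)).card : ℝ) /
        ((p.1.2 - p.1.1 : ℤ) : ℝ)) := by
  refine ⟨2, ?_⟩
  rintro _ ⟨⟨⟨n, m⟩, hp⟩, rfl⟩
  have hp' : (1 : ℤ) ≤ m - n := by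
    have : (N : ℤ) ≤ m - n := hp
    lia
  have hr : (1 : ℝ) ≤ ((m - n : ℤ) : ℝ) := by exact_mod_cast hp'
  have := card_filter_Icc_le F (n := n) (m := m) (by lia)
  dsimp only
  rw [div_le_iff₀ (by linarith)]
  linarith

theorem le_upperBanachDensity_of_tendsto_windowFreq {F : Set ℤ} {a b : ℕ → ℤ}
    (hab : ∀ k : ℕ, (k : ℤ) + 1 ≤ b k - a k) {L : Filter ℕ} [L.NeBot] (hL : L ≤ atTop) {c : ℝ}
    (hc : Tendsto (fun k => windowFreq F (a k) (b k)) L (𝓝 c)) :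
    c ≤ upperBanachDensity F := by
  classical
  have : Nonempty {N : ℕ // 1 ≤ N} := ⟨⟨1, le_rfl⟩⟩
  refine le_ciInf fun N => le_of_tendsto hc ?_
  filter_upwards [hL (eventually_ge_atTop N.1)] with k hk
  have hk' : (N.1 : ℤ) ≤ b k - a k := by have := hab k; lia
  have h1 : (1 : ℝ) ≤ ((b k - a k : ℤ) : ℝ) := by
    have := hab k
    exact_mod_cast (by lia : (1 : ℤ) ≤ b k - a k)
  refine le_trans ?_ (le_ciSup (bddAbove_upperBanachDensity_ratio F N.2) ⟨(a k, b k), hk'⟩)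
  rw [windowFreq, Int.cast_card_Icc_of_le (by lia)]
  gcongr
  linarith

theorem exists_windowFreq_ge (F : Set ℤ) (k : ℕ) :
    ∃ n m : ℤ, (k : ℤ) + 1 ≤ m - n ∧
      upperBanachDensity F - 2 / ((k : ℝ) + 1) ≤ windowFreq F n m := by
  classical
  have hbdd : BddBelow (Set.range fun N : {N : ℕ // 1 ≤ N} =>
      ⨆ p : {p : ℤ × ℤ // (N.1 : ℤ) ≤ p.2 - p.1},
        (((Finset.Icc p.1.1 p.1.2).filter (fun x => x ∈ F)).card : ℝ) /
          ((p.1.2 - p.1.1 : ℤ) : ℝ)) := by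
    refine ⟨0, ?_⟩
    rintro _ ⟨N, rfl⟩
    refine Real.iSup_nonneg fun p => div_nonneg (Nat.cast_nonneg _) ?_
    have := p.2
    exact_mod_cast (by lia : (0 : ℤ) ≤ p.1.2 - p.1.1)
  have hle := ciInf_le hbdd ⟨k + 1, by lia⟩
  have hpos : (0 : ℝ) < 1 / ((k : ℝ) + 1) := by positivity
  have : Nonempty {p : ℤ × ℤ // ((k + 1 : ℕ) : ℤ) ≤ p.2 - p.1} := ⟨⟨(0, k + 1), by simp⟩⟩
  obtain ⟨⟨⟨n, m⟩, hp⟩, hlt⟩ := exists_lt_of_lt_ciSup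
    (lt_of_lt_of_le (sub_lt_self (upperBanachDensity F) hpos) hle)
  have hp' : (k : ℤ) + 1 ≤ m - n := by simpa using hp
  refine ⟨n, m, hp', ?_⟩
  have hkl : (k : ℝ) + 1 ≤ ((m - n : ℤ) : ℝ) := by exact_mod_cast hp'
  have hcard := card_filter_Icc_le F (n := n) (m := m) (by lia)
  rw [windowFreq, Int.cast_card_Icc_of_le (by lia)]
  dsimp only at hlt
  set l : ℝ := ((m - n : ℤ) : ℝ)
  set c : ℝ := (((Finset.Icc n m).filter (fun x => x ∈ F)).card : ℝ)
  have hl : 0 < l := by have : (0 : ℝ) ≤ k := Nat.cast_nonneg k; linarith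
  have h1 : c / l - c / (l + 1) ≤ 1 / ((k : ℝ) + 1) := calc
    c / l - c / (l + 1) = (c / (l + 1)) * (1 / l) := by field_simp; ring
    _ ≤ 1 * (1 / l) := by
      gcongr
      exact (div_le_one (by linarith)).2 hcard
    _ ≤ 1 / ((k : ℝ) + 1) := by
      rw [one_mul]
      gcongr
  have h2 : 2 / ((k : ℝ) + 1) = 1 / ((k : ℝ) + 1) + 1 / ((k : ℝ) + 1) := by ring
  linarith

theorem abs_windowFreq_shift_sub_le (F : Set ℤ) {n m : ℤ} (h : n ≤ m) :
    |windowFreq {x | x + 1 ∈ F} n m - windowFreq F n m| ≤ 1 / ((m - n : ℤ) + 1 : ℝ) := by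
  classical
  have hinj : Function.Injective fun x : ℤ => x + 1 := add_left_injective 1
  have h1 : ((Finset.Icc n m).filter (fun x => x ∈ {x | x + 1 ∈ F})).card ≤
      ((Finset.Icc n m).filter (fun x => x ∈ F)).card + 1 := by
    rw [← Finset.card_image_of_injective _ hinj]
    refine le_trans (Finset.card_le_card ?_) (Finset.card_insert_le (m + 1) _)
    intro y
    simp only [Finset.mem_image, Finset.mem_filter, Finset.mem_Icc, Finset.mem_insert,
      Set.mem_ofPred_eq]
    rintro ⟨x, ⟨hx, hxF⟩, rfl⟩
    by_cases hxm : x = m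
    · exact Or.inl (by rw [hxm])
    · exact Or.inr ⟨by lia, hxF⟩
  have h2 : ((Finset.Icc n m).filter (fun x => x ∈ F)).card ≤
      ((Finset.Icc n m).filter (fun x => x ∈ {x | x + 1 ∈ F})).card + 1 := by
    rw [← Finset.card_image_of_injective
      ((Finset.Icc n m).filter (fun x => x ∈ {x | x + 1 ∈ F})) hinj]
    refine le_trans (Finset.card_le_card ?_) (Finset.card_insert_le n _)
    intro y
    simp only [Finset.mem_image, Finset.mem_filter, Finset.mem_Icc, Finset.mem_insert,
      Set.mem_ofPred_eq]
    rintro ⟨hy, hyF⟩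
    by_cases hyn : y = n
    · exact Or.inl hyn
    · exact Or.inr ⟨y - 1, ⟨by lia, by simpa using hyF⟩, by ring⟩
  have hl : (0 : ℝ) ≤ ((m - n : ℤ) : ℝ) := by exact_mod_cast (by lia : (0 : ℤ) ≤ m - n)
  rw [windowFreq, windowFreq, Int.cast_card_Icc_of_le h, ← sub_div, abs_div,
    abs_of_pos (by linarith : (0 : ℝ) < ((m - n : ℤ) : ℝ) + 1)]
  gcongr
  have h1' := (Nat.cast_le (α := ℝ)).2 h1
  have h2' := (Nat.cast_le (α := ℝ)).2 h2
  push_cast at h1' h2'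
  rw [abs_le]
  constructor <;> linarith

/-- The sequences that take the value `true` at every index in `U`. -/
def trueCylinder (U : Finset ℤ) : Set (ℤ → Bool) := {y | ∀ i ∈ U, y i = true}

theorem isClopen_trueCylinder (U : Finset ℤ) : IsClopen (trueCylinder U) := by
  have : trueCylinder U = ⋂ i ∈ U, (fun y : ℤ → Bool => y i) ⁻¹' {true} := by
    ext y
    simp [trueCylinder]
  rw [this]
  exact U.finite_toSet.isClopen_biInter fun i _ =>
    (isClopen_discrete {true}).preimage (continuous_apply i)

theorem isPiSystem_range_trueCylinder : IsPiSystem (Set.range trueCylinder) := by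
  rintro _ ⟨U, rfl⟩ _ ⟨V, rfl⟩ -
  refine ⟨U ∪ V, ?_⟩
  ext y
  simp only [trueCylinder, Finset.mem_union, Set.mem_inter_iff, Set.mem_ofPred_eq]
  grind

theorem generateFrom_range_trueCylinder :
    (inferInstance : MeasurableSpace (ℤ → Bool)) =
      MeasurableSpace.generateFrom (Set.range trueCylinder) := by
  refine le_antisymm (iSup_le fun i => ?_) (MeasurableSpace.generateFrom_le ?_)
  · rw [← measurable_iff_comap_le]
    refine @measurable_to_bool _ (_) _ (MeasurableSpace.measurableSet_generateFrom ⟨{i}, ?_⟩)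
    ext y
    simp [trueCylinder]
  · rintro _ ⟨U, rfl⟩
    exact (isClopen_trueCylinder U).isOpen.measurableSet

open Classical in
/-- The orbit of the indicator sequence of `E` under the shift. -/
noncomputable def indicatorOrbit (E : Set ℤ) (x : ℤ) : ℤ → Bool := fun i => decide (x + i ∈ E)

theorem exists_tendsto_windowFreq (E : Set ℤ) {a b : ℕ → ℤ} (hab : ∀ k, a k ≤ b k) :
    ∃ (μ : ProbabilityMeasure (ℤ → Bool)) (L : Filter ℕ), L.NeBot ∧ L ≤ atTop ∧
      ∀ U : Finset ℤ,
        Tendsto (fun k => windowFreq (⋂ i ∈ U, {x : ℤ | x + i ∈ E}) (a k) (b k)) L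
          (𝓝 ((μ : Measure (ℤ → Bool)) (trueCylinder U)).toReal) := by
  classical
  let μs : ℕ → ProbabilityMeasure (ℤ → Bool) := fun k =>
    ⟨(PMF.uniformOfFinset (Finset.Icc (a k) (b k)) (Finset.nonempty_Icc.2 (hab k))).toMeasure.map
      (indicatorOrbit E), Measure.isProbabilityMeasure_map (measurable_of_countable _).aemeasurable⟩
  have hμs : Tendsto μs (hyperfilter ℕ) (𝓝 ((hyperfilter ℕ).map μs).lim) :=
    ((hyperfilter ℕ).map μs).le_nhds_lim
  refine ⟨((hyperfilter ℕ).map μs).lim, hyperfilter ℕ, inferInstance, Nat.hyperfilter_le_atTop, fun U => ?_⟩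
  have h := (ENNReal.tendsto_toReal (measure_ne_top _ _)).comp
    (ProbabilityMeasure.tendsto_measure_of_null_frontier_of_tendsto' hμs
      (E := trueCylinder U) (by simp [(isClopen_trueCylinder U).frontier_eq]))
  refine h.congr fun k => ?_
  simp only [Function.comp_apply, μs, ProbabilityMeasure.coe_mk]
  rw [Measure.map_apply (measurable_of_countable _) (isClopen_trueCylinder U).isOpen.measurableSet,
    PMF.toMeasure_uniformOfFinset_apply _ _ MeasurableSet.of_discrete, windowFreq,
    ENNReal.toReal_div, ENNReal.toReal_natCast, ENNReal.toReal_natCast]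
  congr 3
  ext x
  simp [trueCylinder, indicatorOrbit]

/-- The left shift on two-sided sequences. -/
def shiftEquiv : (ℤ → Bool) ≃ (ℤ → Bool) where
  toFun y x := y (x + 1)
  invFun y x := y (x - 1)
  left_inv y := by ext x; simp
  right_inv y := by ext x; simp

theorem shiftEquiv_zpow_apply (i : ℤ) (y : ℤ → Bool) (x : ℤ) :
    (shiftEquiv ^ i : (ℤ → Bool) ≃ (ℤ → Bool)) y x = y (x + i) := by
  induction i using Int.induction_on generalizing y with
  | zero => simp
  | succ k ih =>
    rw [zpow_add_one, Equiv.Perm.mul_apply, ih]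
    simp [shiftEquiv, add_assoc]
  | pred k ih =>
    rw [zpow_sub_one, Equiv.Perm.mul_apply, ih]
    change y (x + -(k : ℤ) - 1) = _
    rw [add_sub_assoc]

theorem measurable_shiftEquiv : Measurable shiftEquiv :=
  measurable_pi_lambda _ fun x => measurable_pi_apply (x + 1)

theorem measurable_shiftEquiv_symm : Measurable shiftEquiv.symm :=
  measurable_pi_lambda _ fun x => measurable_pi_apply (x - 1)

theorem shiftEquiv_preimage_trueCylinder (U : Finset ℤ) :
    shiftEquiv ⁻¹' trueCylinder U = trueCylinder (U.map (addRightEmbedding 1)) := by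
  ext y
  simp [trueCylinder, shiftEquiv]

theorem measurePreserving_shiftEquiv {E : Set ℤ} {a b : ℕ → ℤ}
    (hab : ∀ k : ℕ, (k : ℤ) + 1 ≤ b k - a k) {L : Filter ℕ} [L.NeBot] (hL : L ≤ atTop)
    {μ : Measure (ℤ → Bool)} [IsProbabilityMeasure μ]
    (hμ : ∀ U : Finset ℤ,
      Tendsto (fun k => windowFreq (⋂ i ∈ U, {x : ℤ | x + i ∈ E}) (a k) (b k)) L
        (𝓝 (μ (trueCylinder U)).toReal)) :
    MeasurePreserving shiftEquiv μ μ := by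
  refine ⟨measurable_shiftEquiv, ?_⟩
  have := Measure.isProbabilityMeasure_map (μ := μ) measurable_shiftEquiv.aemeasurable
  refine ext_of_generate_finite _ generateFrom_range_trueCylinder isPiSystem_range_trueCylinder
    ?_ (by simp)
  rintro _ ⟨U, rfl⟩
  rw [Measure.map_apply measurable_shiftEquiv (isClopen_trueCylinder U).isOpen.measurableSet,
    shiftEquiv_preimage_trueCylinder,
    ← ENNReal.toReal_eq_toReal_iff' (measure_ne_top _ _) (measure_ne_top _ _), ← sub_eq_zero]
  refine tendsto_nhds_unique ((hμ _).sub (hμ U)) ?_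
  have hset : (⋂ i ∈ U.map (addRightEmbedding 1), {x : ℤ | x + i ∈ E}) =
      {x | x + 1 ∈ ⋂ i ∈ U, {x : ℤ | x + i ∈ E}} := by
    ext x
    simp [add_comm, add_left_comm]
  rw [hset]
  refine squeeze_zero_norm (fun k => ?_) (tendsto_one_div_add_atTop_nhds_zero_nat.mono_left hL)
  have hk := hab k
  refine (abs_windowFreq_shift_sub_le _ (by lia)).trans ?_
  gcongr
  exact_mod_cast (by lia : (k : ℤ) ≤ b k - a k)

/-- The Furstenberg correspondence principle. -/
theorem furstenberg_correspondence (E : Set ℤ) (hE : 0 < upperBanachDensity E) :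
    ∃ (Y : Type) (_ : MeasurableSpace Y) (μ : Measure Y) (T : Y ≃ Y),
      IsProbabilityMeasure μ ∧
      Measurable T ∧ Measurable T.symm ∧
      (∀ S : Set Y, MeasurableSet S → μ (T ⁻¹' S) = μ S) ∧
      ∃ A : Set Y, MeasurableSet A ∧ (μ A).toReal = upperBanachDensity E ∧
        ∀ U : Finset ℤ,
          (μ (⋂ i ∈ U, (⇑(T ^ i : Y ≃ Y)) ⁻¹' A)).toReal ≤
            upperBanachDensity (⋂ i ∈ U, {x : ℤ | x + i ∈ E}) := by
  choose a b hab hfreq using exists_windowFreq_ge E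
  obtain ⟨μ, L, hLne, hL, hμ⟩ := exists_tendsto_windowFreq E (a := a) (b := b)
    fun k => by have := hab k; lia
  have hT := measurePreserving_shiftEquiv hab hL hμ
  refine ⟨ℤ → Bool, inferInstance, μ, shiftEquiv, inferInstance, measurable_shiftEquiv,
    measurable_shiftEquiv_symm, fun S hS => hT.measure_preimage hS.nullMeasurableSet,
    trueCylinder {0}, (isClopen_trueCylinder _).isOpen.measurableSet, ?_, fun U => ?_⟩
  · have h0 := hμ {0}
    have hset : (⋂ i ∈ ({0} : Finset ℤ), {x : ℤ | x + i ∈ E}) = E := by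
      ext x
      simp
    rw [hset] at h0
    refine le_antisymm (le_upperBanachDensity_of_tendsto_windowFreq hab hL h0) ?_
    refine le_of_tendsto_of_tendsto' ?_ h0 hfreq
    have hz := ((tendsto_one_div_add_atTop_nhds_zero_nat (𝕜 := ℝ)).mono_left hL).const_mul 2
    simpa [div_eq_mul_inv] using hz.const_sub (upperBanachDensity E)
  · have hset : (⋂ i ∈ U, (⇑(shiftEquiv ^ i : (ℤ → Bool) ≃ (ℤ → Bool))) ⁻¹' trueCylinder {0}) =
        trueCylinder U := by
      ext y
      simp [trueCylinder, shiftEquiv_zpow_apply]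
    rw [hset]
    exact le_upperBanachDensity_of_tendsto_windowFreq hab hL (hμ U)
end

section
/- For every ε > 0, every positive integer k, and every finite k-uniform hypergraph (W, F), there is a δ > 0 such that the following holds: whenever (V, E) is a finite k-uniform hypergraph such that the number of copies of (W,F) in (V,E) is at most δ·|V|^{|W|}, there is a subset E' ⊆ E with |E \ E'| ≤ ε·|V|^k such that the hypergraph (V, E') contains no copy of (W, F). -/
open Classical in
/-- The number of copies of the `k`-uniform hypergraph `(W, F)` in `(V, E)`: the number of
functions `φ : W → V` such that for every edge `I ∈ F`, `φ` is injective on `I` and the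
image `φ(I)` is an edge of `E`. -/
noncomputable def copyCount (W V : Type) [Fintype W] [Fintype V] [DecidableEq V]
    (F : Finset (Finset W)) (E : Finset (Finset V)) : ℕ :=
  Nat.card {φ : W → V // ∀ I ∈ F, Set.InjOn φ ↑I ∧ Finset.image φ I ∈ E}

namespace HypergraphRemoval

section

open MeasureTheory Set
open scoped symmDiff

theorem exists_mem_algebra_symmDiff_lt {X : Type*} {m0 : MeasurableSpace X} (μ : Measure X)
    [IsFiniteMeasure μ] {𝒜 : Set (Set X)} (h𝒜 : IsSetAlgebra 𝒜)
    (hle : MeasurableSpace.generateFrom 𝒜 ≤ m0) {S : Set X}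
    (hS : MeasurableSet[MeasurableSpace.generateFrom 𝒜] S) {ε : ℝ} (hε : 0 < ε) :
    ∃ T ∈ 𝒜, μ.real (S ∆ T) < ε := by
  have hd := Measure.MeasureDense.of_generateFrom_isSetAlgebra_finite
    (m := MeasurableSpace.generateFrom 𝒜) (μ := μ.trim hle) h𝒜 rfl
  obtain ⟨T, hT, h⟩ :=
    @Measure.MeasureDense.approx X (MeasurableSpace.generateFrom 𝒜) _ _ hd S hS
      (measure_ne_top _ _) ε hε
  refine ⟨T, hT, ?_⟩
  rw [trim_measurableSet_eq hle
    (hS.symmDiff (MeasurableSpace.measurableSet_generateFrom hT))] at h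
  rw [measureReal_def]
  exact ENNReal.toReal_lt_of_lt_ofReal h

theorem IsSetAlgebra.biInter_finite_mem {X ι : Type*} {𝒜 : Set (Set X)} (h𝒜 : IsSetAlgebra 𝒜)
    [Finite ι] {S : ι → Set X} (hS : ∀ i, S i ∈ 𝒜) : ⋂ i, S i ∈ 𝒜 := by
  classical
  cases nonempty_fintype ι
  have := h𝒜.biInter_mem (s := S) Finset.univ (fun i _ => hS i)
  simpa using this

theorem IsSetAlgebra.preimage_mem {X C : Type*} {𝒜 : Set (Set X)} (h𝒜 : IsSetAlgebra 𝒜)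
    [Finite C] {f : X → C} (hf : ∀ c, f ⁻¹' {c} ∈ 𝒜) (T : Set C) : f ⁻¹' T ∈ 𝒜 := by
  classical
  cases nonempty_fintype C
  have := h𝒜.biUnion_mem (s := fun c => f ⁻¹' {c}) T.toFinset (fun i _ => hf i)
  convert this using 1
  ext x
  simp

/-- A finitely valued function measurable for the `σ`-algebra generated by an algebra of sets is
close in measure to one whose fibres lie in the algebra. -/
theorem exists_fiber_mem_algebra_approx {X C : Type*} {m0 : MeasurableSpace X} (μ : Measure X)
    [IsFiniteMeasure μ] {𝒜 : Set (Set X)} (h𝒜 : IsSetAlgebra 𝒜)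
    (hle : MeasurableSpace.generateFrom 𝒜 ≤ m0) [Finite C] [Nonempty C] {γ : X → C}
    (hγ : ∀ c, MeasurableSet[MeasurableSpace.generateFrom 𝒜] (γ ⁻¹' {c})) {ε : ℝ} (hε : 0 < ε) :
    ∃ γ' : X → C, (∀ c, γ' ⁻¹' {c} ∈ 𝒜) ∧ μ.real {x | γ x ≠ γ' x} ≤ ε := by
  classical
  cases nonempty_fintype C
  have hN : (0 : ℝ) < Fintype.card C := by exact_mod_cast Fintype.card_pos
  choose T hT hlt using fun c => exists_mem_algebra_symmDiff_lt μ h𝒜 hle (hγ c)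
    (div_pos hε hN)
  let τ : X → Set C := fun x => {c | x ∈ T c}
  have hτ : ∀ P : Set C, τ ⁻¹' {P} ∈ 𝒜 := by
    intro P
    have : τ ⁻¹' {P} = ⋂ c, (if c ∈ P then T c else (T c)ᶜ) := by
      ext x
      simp only [mem_preimage, mem_singleton_iff, mem_iInter, Set.ext_iff, τ, mem_ofPred_eq]
      refine forall_congr' fun c => ?_
      by_cases hc : c ∈ P <;> simp [hc]
    rw [this]
    refine IsSetAlgebra.biInter_finite_mem h𝒜 fun c => ?_
    split_ifs
    · exact hT c
    · exact h𝒜.compl_mem (hT c)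
  let G : Set C → C := fun P => if h : ∃ c, P = {c} then h.choose else Classical.arbitrary C
  have hG : ∀ c, G {c} = c := by
    intro c
    have h : ∃ c', ({c} : Set C) = {c'} := ⟨c, rfl⟩
    simp only [G, dif_pos h]
    exact (Set.singleton_eq_singleton_iff.1 h.choose_spec).symm
  refine ⟨fun x => G (τ x), fun c => ?_, ?_⟩
  · exact IsSetAlgebra.preimage_mem h𝒜 hτ (G ⁻¹' {c})
  · have hsub : {x | γ x ≠ G (τ x)} ⊆ ⋃ c, (γ ⁻¹' {c}) ∆ T c := by
      intro x hx
      by_contra hcon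
      simp only [mem_iUnion, not_exists, Set.mem_symmDiff, mem_preimage, mem_singleton_iff] at hcon
      apply hx
      have : τ x = {γ x} := by
        ext c
        have := hcon c
        simp only [τ, mem_ofPred_eq, mem_singleton_iff]
        tauto
      rw [this, hG]
    calc μ.real {x | γ x ≠ G (τ x)} ≤ μ.real (⋃ c, (γ ⁻¹' {c}) ∆ T c) :=
          measureReal_mono hsub
      _ ≤ ∑ c, μ.real ((γ ⁻¹' {c}) ∆ T c) := measureReal_iUnion_fintype_le _
      _ ≤ ∑ _c : C, ε / Fintype.card C := Finset.sum_le_sum fun c _ => (hlt c).le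
      _ = ε := by
          rw [Finset.sum_const, Finset.card_univ, nsmul_eq_mul]
          field_simp

/-- The sets determined by finitely many values of functions, the `i`-th one being measurable for
`B i` and constant unless `P i`. -/
def cellAlgebra {X ι : Type} (B : ι → MeasurableSpace X) (P : ι → Prop) : Set (Set X) :=
  {S | ∃ (Q : Type) (_ : Finite Q) (q0 : Q) (q : ι → X → Q),
    (∀ i a, MeasurableSet[B i] (q i ⁻¹' {a})) ∧ (∀ i, ¬ P i → q i = fun _ => q0) ∧
    ∃ T : Set (ι → Q), S = (fun x i => q i x) ⁻¹' T}

theorem isSetAlgebra_cellAlgebra {X ι : Type} (B : ι → MeasurableSpace X)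
    (P : ι → Prop) : IsSetAlgebra (cellAlgebra B P) where
  empty_mem := ⟨Unit, inferInstance, (), fun _ _ => (), by
    intro i a
    convert MeasurableSet.univ
    ext; simp, fun _ _ => rfl, ∅, by simp⟩
  compl_mem := by
    rintro S ⟨Q, hQ, q0, q, h1, h2, T, rfl⟩
    exact ⟨Q, hQ, q0, q, h1, h2, Tᶜ, rfl⟩
  union_mem := by
    rintro S S' ⟨Q, hQ, q0, q, h1, h2, T, rfl⟩ ⟨Q', hQ', q0', q', h1', h2', T', rfl⟩
    refine ⟨Q × Q', inferInstance, (q0, q0'), fun i x => (q i x, q' i x), ?_, ?_,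
      {v | (fun i => (v i).1) ∈ T ∨ (fun i => (v i).2) ∈ T'}, ?_⟩
    · rintro i ⟨a, a'⟩
      convert (h1 i a).inter (h1' i a') using 1
      ext x; simp
    · intro i hi
      funext x
      simp only [h2 i hi, h2' i hi]
    · ext x; simp

theorem generateFrom_cellAlgebra {X ι : Type} [Finite ι] (B : ι → MeasurableSpace X)
    (P : ι → Prop) :
    MeasurableSpace.generateFrom (cellAlgebra B P) = ⨆ i, ⨆ (_ : P i), B i := by
  classical
  apply le_antisymm
  · apply MeasurableSpace.generateFrom_le
    rintro S ⟨Q, hQ, q0, q, h1, h2, T, rfl⟩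
    have : (fun x i => q i x) ⁻¹' T = ⋃ v : T, ⋂ i, q i ⁻¹' {(v : ι → Q) i} := by
      ext x
      simp only [mem_preimage, mem_iUnion, mem_iInter, mem_singleton_iff]
      constructor
      · intro h
        exact ⟨⟨_, h⟩, fun i => rfl⟩
      · rintro ⟨v, hv⟩
        have : (fun i => q i x) = v := funext hv
        rw [this]; exact v.2
    rw [this]
    refine MeasurableSet.iUnion fun v => MeasurableSet.iInter fun i => ?_
    by_cases hi : P i
    · exact (le_iSup₂_of_le i hi le_rfl : B i ≤ _) _ (h1 i _)
    · rw [h2 i hi]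
      exact MeasurableSet.const _
  · refine iSup₂_le fun i hi => ?_
    intro S hS
    apply MeasurableSpace.measurableSet_generateFrom
    refine ⟨Bool, inferInstance, false, fun j x => if j = i then decide (x ∈ S) else false,
      ?_, ?_, {v | v i = true}, ?_⟩
    · intro j a
      by_cases hj : j = i
      · subst hj
        cases a
        · convert hS.compl using 1; ext x; simp
        · convert hS using 1; ext x; simp
      · simp only [hj, if_false]
        exact MeasurableSet.const _
    · intro j hj
      have : j ≠ i := fun h => hj (h ▸ hi)
      simp [this]
    · ext x; simp

/-- A finitely valued function measurable for a join of `σ`-algebras is close in measure to a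
function of finitely valued functions measurable for the individual `σ`-algebras. -/
theorem exists_cell_approx {X ι C : Type} [Finite ι] {m0 : MeasurableSpace X} (μ : Measure X)
    [IsFiniteMeasure μ] (B : ι → MeasurableSpace X) (hB : ∀ i, B i ≤ m0) (P : ι → Prop)
    [Finite C] [Nonempty C] {γ : X → C}
    (hγ : ∀ c, MeasurableSet[⨆ i, ⨆ (_ : P i), B i] (γ ⁻¹' {c})) {ε : ℝ} (hε : 0 < ε) :
    ∃ (Q : Type) (_ : Finite Q) (q0 : Q) (q : ι → X → Q) (g : (ι → Q) → C),
      (∀ i a, MeasurableSet[B i] (q i ⁻¹' {a})) ∧ (∀ i, ¬ P i → q i = fun _ => q0) ∧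
      μ.real {x | γ x ≠ g (fun i => q i x)} ≤ ε := by
  classical
  cases nonempty_fintype C
  rw [← generateFrom_cellAlgebra] at hγ
  obtain ⟨γ', h1, h2⟩ := exists_fiber_mem_algebra_approx μ (isSetAlgebra_cellAlgebra B P)
    (by rw [generateFrom_cellAlgebra]; exact iSup₂_le fun i _ => hB i) hγ hε
  choose Q hQ q0 q hm hc T hT using h1
  let g : (ι → ∀ c, Q c) → C := fun v =>
    if h : ∃ c, (fun i => v i c) ∈ T c then h.choose else Classical.arbitrary C
  have hg : ∀ x, g (fun i c => q c i x) = γ' x := by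
    intro x
    have hmem : ∀ c, (fun i => q c i x) ∈ T c ↔ γ' x = c := by
      intro c
      have : x ∈ γ' ⁻¹' {c} ↔ x ∈ (fun x i => q c i x) ⁻¹' T c := by rw [← hT c]
      simpa using this.symm
    have h : ∃ c, (fun i => q c i x) ∈ T c := ⟨γ' x, (hmem _).2 rfl⟩
    simp only [g, dif_pos h]
    exact ((hmem _).1 h.choose_spec).symm
  refine ⟨∀ c, Q c, inferInstance, q0, fun i x c => q c i x, g, ?_, ?_, ?_⟩
  · intro i a
    have : (fun x c => q c i x) ⁻¹' {a} = ⋂ c, q c i ⁻¹' {a c} := by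
      ext x; simp [funext_iff]
    rw [this]
    exact MeasurableSet.iInter fun c => hm c i (a c)
  · intro i hi
    funext x c
    simp only [hc c i hi]
  · simpa only [hg] using h2

theorem integrable_of_bounded {X : Type*} {m0 : MeasurableSpace X} {μ : Measure X}
    [IsFiniteMeasure μ] {g : X → ℝ} (hg : Measurable g) {K : ℝ} (hK : ∀ x, |g x| ≤ K) :
    Integrable g μ :=
  Integrable.of_bound hg.aestronglyMeasurable K (Filter.Eventually.of_forall hK)

/-- Conditional probabilities of the fibres of a finitely valued function. -/
theorem exists_condProb {X D : Type*} {m m0 : MeasurableSpace X} (hm : m ≤ m0) (μ : Measure X)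
    [IsProbabilityMeasure μ] [Fintype D] [DecidableEq D] {d : X → D}
    (hd : ∀ e, MeasurableSet[m0] (d ⁻¹' {e})) :
    ∃ f : D → X → ℝ, (∀ e, Measurable[m] (f e)) ∧ (∀ e x, 0 ≤ f e x) ∧ (∀ x, ∑ e, f e x ≤ 1) ∧
      ∀ e (g : X → ℝ) (K : ℝ), Measurable[m] g → (∀ x, |g x| ≤ K) →
        ∫ x, (if d x = e then g x else 0) ∂μ = ∫ x, f e x * g x ∂μ := by
  classical
  let ind : D → X → ℝ := fun e x => if d x = e then 1 else 0
  have hind : ∀ e, Measurable (ind e) := fun e =>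
    Measurable.ite (hd e) measurable_const measurable_const
  have hindb : ∀ e x, |ind e x| ≤ 1 := by
    intro e x
    simp only [ind]
    split_ifs <;> simp
  have hindi : ∀ e, Integrable (ind e) μ := fun e => integrable_of_bounded (hind e) (hindb e)
  let f0 : D → X → ℝ := fun e => μ[ind e|m]
  have hf0 : ∀ e, Measurable[m] (f0 e) := fun e => stronglyMeasurable_condExp.measurable
  let V : Set X := {x | (∀ e, 0 ≤ f0 e x) ∧ ∑ e, f0 e x ≤ 1}
  have hV : MeasurableSet[m] V := by
    have hVeq : V = (⋂ e, {x | 0 ≤ f0 e x}) ∩ {x | ∑ e, f0 e x ≤ 1} := by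
      ext x
      simp [V]
    rw [hVeq]
    apply MeasurableSet.inter
    · exact MeasurableSet.iInter fun e => measurableSet_le measurable_const (hf0 e)
    · exact measurableSet_le (Finset.measurable_sum _ fun e _ => hf0 e) measurable_const
  have hVae : ∀ᵐ x ∂μ, x ∈ V := by
    have h1 : ∀ᵐ x ∂μ, ∀ e, 0 ≤ f0 e x := by
      rw [ae_all_iff]
      intro e
      have := condExp_nonneg (m := m) (μ := μ) (f := ind e)
        (Filter.Eventually.of_forall fun x => by simp only [ind]; split_ifs <;> simp)
      exact this
    have h2 : ∑ e, f0 e =ᵐ[μ] fun _ => (1 : ℝ) := by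
      have h3 := condExp_finsetSum (s := Finset.univ) (f := ind) (fun e _ => hindi e) m (μ := μ)
      refine h3.symm.trans ?_
      have : ∑ e, ind e = fun _ => (1 : ℝ) := by
        funext x
        simp [ind]
      rw [this, condExp_const hm]
    filter_upwards [h1, h2] with x hx1 hx2
    refine ⟨hx1, ?_⟩
    rw [Finset.sum_apply] at hx2
    exact hx2.le
  refine ⟨fun e x => if x ∈ V then f0 e x else 0, ?_, ?_, ?_, ?_⟩
  · intro e
    exact Measurable.ite hV (hf0 e) measurable_const
  · intro e x
    dsimp only
    split_ifs with h
    · exact h.1 e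
    · exact le_rfl
  · intro x
    by_cases h : x ∈ V
    · simpa [h] using h.2
    · simp [h]
  · intro e g K hg hK
    have e1 : ∫ x, (if d x = e then g x else 0) ∂μ = ∫ x, (ind e * g) x ∂μ := by
      congr 1
      funext x
      simp [ind]
    have hint : Integrable (ind e * g) μ := by
      refine integrable_of_bounded ((hind e).mul (hg.mono hm le_rfl)) (K := K) fun x => ?_
      rw [Pi.mul_apply, abs_mul]
      have h0 : 0 ≤ K := (abs_nonneg _).trans (hK x)
      calc |ind e x| * |g x| ≤ 1 * K :=
            mul_le_mul (hindb e x) (hK x) (abs_nonneg _) zero_le_one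
        _ = K := one_mul K
    rw [e1, ← integral_condExp hm]
    apply integral_congr_ae
    have h4 := condExp_mul_of_stronglyMeasurable_right (m := m) (μ := μ)
      (hg.stronglyMeasurable) hint (hindi e)
    filter_upwards [h4, hVae] with x hx hxV
    rw [hx]
    simp [hxV, f0]

/-- Change the conditional law of a finitely valued function to a prescribed one which is close to
it, introducing an extra value. -/
theorem exists_coupling {X D A : Type*} {m mJ m0 : MeasurableSpace X} (hm : m ≤ mJ) (hJ : mJ ≤ m0)
    (μ : Measure X) [IsProbabilityMeasure μ] [Fintype D] [DecidableEq D] {d : X → D}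
    (hd : ∀ e, MeasurableSet[mJ] (d ⁻¹' {e}))
    {f : D → X → ℝ} (hf : ∀ e, Measurable[m] (f e)) (hf0 : ∀ e x, 0 ≤ f e x)
    (hfd : ∀ e (g : X → ℝ) (K : ℝ), Measurable[m] g → (∀ x, |g x| ≤ K) →
        ∫ x, (if d x = e then g x else 0) ∂μ = ∫ x, f e x * g x ∂μ)
    (qh : X → A) (F : A → D → ℝ) (hF0 : ∀ a e, 0 ≤ F a e) (hF1 : ∀ a, ∑ e, F a e ≤ 1)
    (hFm : ∀ e, Measurable[m] (fun x => F (qh x) e))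
    (G : Set X) (hG : MeasurableSet[m] G) (κ : ℝ) (hκ : 0 ≤ κ)
    (hGle : ∀ x ∈ G, ∀ e, F (qh x) e ≤ f e x)
    (hGge : ∀ x ∈ G, ∀ e, f e x - F (qh x) e ≤ κ) :
    ∃ t : Option D → X → ℝ, (∀ o, Measurable[mJ] (t o)) ∧ (∀ o x, 0 ≤ t o x) ∧
      (∀ x, ∑ o, t o x = 1) ∧
      (∀ e (S : Set X), MeasurableSet[m] S →
        ∫ x in S, t (some e) x ∂μ = ∫ x in S, F (qh x) e ∂μ) ∧
      ∫ x, (1 - t (some (d x)) x) ∂μ ≤ Fintype.card D * κ + μ.real Gᶜ := by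
  classical
  have hm0 : m ≤ m0 := hm.trans hJ
  have hF1' : ∀ a e, F a e ≤ 1 := fun a e =>
    (Finset.single_le_sum (fun i _ => hF0 a i) (Finset.mem_univ e)).trans (hF1 a)
  let s : D → X → ℝ := fun e x =>
    if x ∈ G then (if d x = e then F (qh x) e / f e x else 0) else F (qh x) e
  have hdiv : ∀ x ∈ G, ∀ e, F (qh x) e / f e x ≤ 1 := fun x hx e =>
    div_le_one_of_le₀ (hGle x hx e) (hf0 e x)
  have hdiv0 : ∀ x e, 0 ≤ F (qh x) e / f e x := fun x e => div_nonneg (hF0 _ _) (hf0 _ _)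
  have hmul : ∀ x ∈ G, ∀ e, f e x * (F (qh x) e / f e x) = F (qh x) e := by
    intro x hx e
    by_cases h : f e x = 0
    · have h1 := hGle x hx e
      have h2 := hF0 (qh x) e
      rw [h] at h1
      rw [h, zero_mul]
      linarith
    · field_simp
  have hs0 : ∀ e x, 0 ≤ s e x := by
    intro e x
    simp only [s]
    split_ifs
    · exact hdiv0 x e
    · exact le_rfl
    · exact hF0 _ _
  have hs1 : ∀ x, ∑ e, s e x ≤ 1 := by
    intro x
    by_cases hx : x ∈ G
    · simp only [s, hx, if_true, Finset.sum_ite_eq, Finset.mem_univ]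
      exact hdiv x hx _
    · simp only [s, hx, if_false]
      exact hF1 _
  have hs1' : ∀ e x, s e x ≤ 1 := fun e x =>
    (Finset.single_le_sum (f := fun e => s e x) (fun i _ => hs0 i x) (Finset.mem_univ e)).trans
      (hs1 x)
  have hsm : ∀ e, Measurable[mJ] (s e) := fun e =>
    Measurable.ite (hm _ hG)
      (Measurable.ite (hd e) (((hFm e).div (hf e)).mono hm le_rfl) measurable_const)
      ((hFm e).mono hm le_rfl)
  let t : Option D → X → ℝ := fun o x => o.elim (1 - ∑ e, s e x) (fun e => s e x)
  refine ⟨t, ?_, ?_, ?_, ?_, ?_⟩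
  · rintro (_ | e)
    · exact measurable_const.sub (Finset.measurable_sum _ fun e _ => hsm e)
    · exact hsm e
  · rintro (_ | e) x
    · exact sub_nonneg.2 (hs1 x)
    · exact hs0 e x
  · intro x
    simp [Fintype.sum_option, t]
  · intro e S hS
    have hSG : MeasurableSet[m] (S ∩ G) := hS.inter hG
    let g : X → ℝ := fun x => if x ∈ S ∩ G then F (qh x) e / f e x else 0
    have hg : Measurable[m] g := Measurable.ite hSG ((hFm e).div (hf e)) measurable_const
    have hgb : ∀ x, |g x| ≤ 1 := by
      intro x
      simp only [g]
      split_ifs with h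
      · rw [abs_of_nonneg (hdiv0 x e)]
        exact hdiv x h.2 e
      · simp
    let h : X → ℝ := fun x => if x ∈ S \ G then F (qh x) e else 0
    have hh : Integrable h μ := by
      refine integrable_of_bounded (K := 1)
        (Measurable.ite (hm0 _ (hS.diff hG)) ((hFm e).mono hm0 le_rfl) measurable_const) ?_
      intro x
      simp only [h]
      split_ifs
      · rw [abs_of_nonneg (hF0 _ _)]
        exact hF1' _ _
      · simp
    have hgi : Integrable (fun x => if d x = e then g x else 0) μ := by
      refine integrable_of_bounded (K := 1)
        (Measurable.ite (hJ _ (hd e)) (hg.mono hm0 le_rfl) measurable_const) ?_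
      intro x
      split_ifs
      · exact hgb x
      · simp
    have hfgi : Integrable (fun x => f e x * g x) μ := by
      refine integrable_of_bounded (K := 1) (((hf e).mul hg).mono hm0 le_rfl) ?_
      intro x
      simp only [g]
      split_ifs with h
      · rw [hmul x h.2 e, abs_of_nonneg (hF0 _ _)]
        exact hF1' _ _
      · simp
    have e1 : ∫ x in S, t (some e) x ∂μ = ∫ x, ((if d x = e then g x else 0) + h x) ∂μ := by
      rw [← integral_indicator (hm0 _ hS)]
      congr 1
      funext x
      by_cases h1 : x ∈ S <;> by_cases h2 : x ∈ G <;> by_cases h3 : d x = e <;>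
        simp [h1, h2, h3, t, s, g, h]
    have e2 : ∫ x in S, F (qh x) e ∂μ = ∫ x, (f e x * g x + h x) ∂μ := by
      rw [← integral_indicator (hm0 _ hS)]
      congr 1
      funext x
      by_cases h1 : x ∈ S <;> by_cases h2 : x ∈ G
      · simp only [h1, h2, indicator_of_mem, g, h, mem_inter_iff, true_and, if_true, mem_sdiff,
          not_true, if_false, add_zero]
        rw [hmul x h2 e]
      · simp [h1, h2, g, h]
      · simp [h1, h2, g, h]
      · simp [h1, h2, g, h]
    rw [e1, e2, integral_add hgi hh, integral_add hfgi hh, hfd e g 1 hg hgb]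
  · let g : D → X → ℝ := fun e x => if x ∈ G then 1 - F (qh x) e / f e x else 0
    have hg : ∀ e, Measurable[m] (g e) := fun e =>
      Measurable.ite hG (measurable_const.sub ((hFm e).div (hf e))) measurable_const
    have hgb : ∀ e x, |g e x| ≤ 1 := by
      intro e x
      simp only [g]
      split_ifs with h
      · rw [abs_of_nonneg (sub_nonneg.2 (hdiv x h e))]
        linarith [hdiv0 x e]
      · simp
    have hgi : ∀ e, Integrable (fun x => if d x = e then g e x else 0) μ := by
      intro e
      refine integrable_of_bounded (K := 1)
        (Measurable.ite (hJ _ (hd e)) ((hg e).mono hm0 le_rfl) measurable_const) ?_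
      intro x
      split_ifs
      · exact hgb e x
      · simp
    have hGi : Integrable (Gᶜ.indicator fun _ => (1 : ℝ)) μ :=
      (integrable_const 1).indicator (hm0 _ hG).compl
    have hle : ∀ x, 1 - t (some (d x)) x ≤
        (∑ e, if d x = e then g e x else 0) + Gᶜ.indicator (fun _ => (1 : ℝ)) x := by
      intro x
      rw [Finset.sum_ite_eq, if_pos (Finset.mem_univ _)]
      by_cases hx : x ∈ G
      · simp [t, s, g, hx]
      · simp only [t, s, g, hx, if_false, Option.elim, mem_compl_iff, not_false_eq_true,
          indicator_of_mem, zero_add]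
        linarith [hF0 (qh x) (d x)]
    have hti : Integrable (fun x => 1 - t (some (d x)) x) μ := by
      have : (fun x => 1 - t (some (d x)) x) = fun x => 1 - ∑ e, if d x = e then s e x else 0 := by
        funext x
        simp [t]
      rw [this]
      refine (integrable_const 1).sub (integrable_finsetSum _ fun e _ => ?_)
      refine integrable_of_bounded (K := 1)
        (Measurable.ite (hJ _ (hd e)) ((hsm e).mono hJ le_rfl) measurable_const) ?_
      intro x
      split_ifs
      · rw [abs_of_nonneg (hs0 e x)]
        exact hs1' e x
      · simp
    calc ∫ x, (1 - t (some (d x)) x) ∂μ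
        ≤ ∫ x, ((∑ e, if d x = e then g e x else 0) + Gᶜ.indicator (fun _ => (1 : ℝ)) x) ∂μ :=
          integral_mono hti ((integrable_finsetSum _ fun e _ => hgi e).add hGi) hle
      _ = ∑ e, ∫ x, f e x * g e x ∂μ + μ.real Gᶜ := by
          rw [integral_add (integrable_finsetSum _ fun e _ => hgi e) hGi,
            integral_finsetSum _ fun e _ => hgi e, integral_indicator_const _ (hm0 _ hG).compl,
            smul_eq_mul, mul_one]
          congr 1
          exact Finset.sum_congr rfl fun e _ => hfd e (g e) 1 (hg e) (hgb e)
      _ ≤ ∑ _e : D, κ + μ.real Gᶜ := by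
          gcongr with e
          have hpt : ∀ x, f e x * g e x ≤ κ := by
            intro x
            simp only [g]
            split_ifs with hx
            · rw [mul_sub, hmul x hx e, mul_one]
              exact hGge x hx e
            · simpa using hκ
          have hpt0 : ∀ x, 0 ≤ f e x * g e x := by
            intro x
            refine mul_nonneg (hf0 e x) ?_
            simp only [g]
            split_ifs with hx
            · exact sub_nonneg.2 (hdiv x hx e)
            · exact le_rfl
          have hi : Integrable (fun x => f e x * g e x) μ :=
            integrable_of_bounded (((hf e).mul (hg e)).mono hm0 le_rfl) (K := κ) fun x => by
              rw [abs_of_nonneg (hpt0 x)]; exact hpt x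
          calc ∫ x, f e x * g e x ∂μ ≤ ∫ _x, κ ∂μ :=
                integral_mono hi (integrable_const _) hpt
            _ = κ := by simp
      _ = Fintype.card D * κ + μ.real Gᶜ := by
          rw [Finset.sum_const, Finset.card_univ, nsmul_eq_mul]

theorem measurable_apply_of_fibers {X D Y : Type*} [Countable D] {m : MeasurableSpace X}
    [MeasurableSpace Y] {d : X → D} (hd : ∀ e, MeasurableSet[m] (d ⁻¹' {e})) {f : D → X → Y}
    (hf : ∀ e, Measurable[m] (f e)) : Measurable[m] fun x => f (d x) x := by
  intro S hS
  have : (fun x => f (d x) x) ⁻¹' S = ⋃ e, d ⁻¹' {e} ∩ f e ⁻¹' S := by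
    ext x
    simp
  rw [this]
  exact MeasurableSet.iUnion fun e => (hd e).inter (hf e hS)

theorem measurableSet_preimage_of_fibers {X D : Type*} [Countable D] {m : MeasurableSpace X}
    {d : X → D} (hd : ∀ e, MeasurableSet[m] (d ⁻¹' {e})) (S : Set D) :
    MeasurableSet[m] (d ⁻¹' S) := by
  have : d ⁻¹' S = ⋃ e ∈ S, d ⁻¹' {e} := by
    ext x
    simp
  rw [this]
  exact MeasurableSet.biUnion (to_countable S) fun e _ => hd e

theorem measurableSet_fiber_pi {X ι Q : Type*} [Finite ι] {m : MeasurableSpace X}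
    {q : ι → X → Q} (hq : ∀ i a, MeasurableSet[m] (q i ⁻¹' {a})) (a : ι → Q) :
    MeasurableSet[m] ((fun x i => q i x) ⁻¹' {a}) := by
  have : (fun x i => q i x) ⁻¹' {a} = ⋂ i, q i ⁻¹' {a i} := by
    ext x
    simp [funext_iff]
  rw [this]
  exact MeasurableSet.iInter fun i => hq i _

/-- A finite family of weight functions, measurable for `mJ`, summing to one, whose conditional
expectations with respect to `m` are constants. -/
structure IsWeight {X C : Type} [Fintype C] {m0 : MeasurableSpace X} (μ : Measure X)
    (m mJ : MeasurableSpace X) (w : C → X → ℝ) (p : C → ℝ) : Prop where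
  measurable : ∀ c, Measurable[mJ] (w c)
  nonneg : ∀ c x, 0 ≤ w c x
  sum_eq : ∀ x, ∑ c, w c x = 1
  setIntegral_eq : ∀ c S, MeasurableSet[m] S → ∫ x in S, w c x ∂μ = p c * μ.real S

namespace IsWeight

variable {X C : Type} [Fintype C] {m0 : MeasurableSpace X} {μ : Measure X}
    {m mJ : MeasurableSpace X} {w : C → X → ℝ} {p : C → ℝ}

theorem le_one (h : IsWeight μ m mJ w p) (c : C) (x : X) : w c x ≤ 1 := by
  rw [← h.sum_eq x]
  exact Finset.single_le_sum (f := fun c => w c x) (fun i _ => h.nonneg i x) (Finset.mem_univ c)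

theorem abs_le_one (h : IsWeight μ m mJ w p) (c : C) (x : X) : |w c x| ≤ 1 := by
  rw [abs_of_nonneg (h.nonneg c x)]
  exact h.le_one c x

theorem integral_eq [IsProbabilityMeasure μ] (h : IsWeight μ m mJ w p) (c : C) :
    ∫ x, w c x ∂μ = p c := by
  have := h.setIntegral_eq c univ MeasurableSet.univ
  simpa using this

theorem const_nonneg [IsProbabilityMeasure μ] (h : IsWeight μ m mJ w p) (c : C) : 0 ≤ p c := by
  rw [← h.integral_eq c]
  exact integral_nonneg (h.nonneg c)

end IsWeight

theorem sum_prod_eq_one {A O : Type} [Fintype A] [DecidableEq A] [Fintype O] (u : A → O → ℝ)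
    (hu : ∀ a, ∑ o, u a o = 1) : ∑ r : A → O, ∏ a, u a (r a) = 1 := by
  have := Finset.prod_univ_sum (fun _ : A => (Finset.univ : Finset O)) u
  rw [Fintype.piFinset_univ] at this
  rw [← this]
  simp [hu]

theorem exists_response {X ι D : Type} [Fintype ι] {m0 : MeasurableSpace X}
    (μ : Measure X) [IsProbabilityMeasure μ] (B : ι → MeasurableSpace X) (hB : ∀ i, B i ≤ m0)
    (P : ι → Prop) {mJ : MeasurableSpace X} (hm : ⨆ i, ⨆ (_ : P i), B i ≤ mJ) (hJ : mJ ≤ m0)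
    [Fintype D] [Nonempty D] [DecidableEq D] {d : X → D} (hd : ∀ e, MeasurableSet[mJ] (d ⁻¹' {e}))
    {η : ℝ} (hη : 0 < η) :
    ∃ (Q R : Type) (_ : Fintype Q) (_ : Fintype R) (q0 : Q) (q : ι → X → Q) (v : R → X → ℝ)
      (p : R → ℝ) (T : R → (ι → Q) → D),
      (∀ i a, MeasurableSet[B i] (q i ⁻¹' {a})) ∧ (∀ i, ¬ P i → q i = fun _ => q0) ∧
      IsWeight μ (⨆ i, ⨆ (_ : P i), B i) mJ v p ∧
      ∫ x, (∑ r, if T r (fun i => q i x) = d x then 0 else v r x) ∂μ ≤ η := by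
  classical
  set m := ⨆ i, ⨆ (_ : P i), B i with hmdef
  obtain ⟨f, hf, hf0, hf1, hfd⟩ := exists_condProb (m := m) (hm.trans hJ) μ
    (fun e => hJ _ (hd e))
  obtain ⟨N, hN⟩ : ∃ N : ℕ, Fintype.card D * (1 / ((N : ℝ) + 1)) ≤ η / 2 := by
    obtain ⟨N, hN⟩ := exists_nat_gt (Fintype.card D / (η / 2))
    refine ⟨N, ?_⟩
    rw [div_lt_iff₀ (by positivity)] at hN
    rw [mul_one_div, div_le_iff₀ (by positivity)]
    nlinarith
  have hN0 : (0 : ℝ) < (N : ℝ) + 1 := by positivity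
  let Cρ : Type := {v : D → Fin (N + 2) // ∑ e, (v e : ℝ) ≤ N + 1}
  have : Nonempty Cρ := ⟨⟨fun _ => 0, by simp; positivity⟩⟩
  have hf1' : ∀ e x, f e x ≤ 1 := fun e x =>
    (Finset.single_le_sum (f := fun e => f e x) (fun i _ => hf0 i x) (Finset.mem_univ e)).trans
      (hf1 x)
  have hfl : ∀ e x, (⌊((N : ℝ) + 1) * f e x⌋₊ : ℝ) ≤ ((N : ℝ) + 1) * f e x := fun e x =>
    Nat.floor_le (mul_nonneg hN0.le (hf0 e x))
  have hflt : ∀ e x, ⌊((N : ℝ) + 1) * f e x⌋₊ < N + 2 := by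
    intro e x
    have h1 : (⌊((N : ℝ) + 1) * f e x⌋₊ : ℝ) ≤ (N + 1 : ℕ) := by
      push_cast
      nlinarith [hfl e x, hf1' e x]
    have := Nat.cast_le.1 h1
    omega
  let ρ : X → Cρ := fun x => ⟨fun e => ⟨⌊((N : ℝ) + 1) * f e x⌋₊, hflt e x⟩, by
    calc ∑ e, (⌊((N : ℝ) + 1) * f e x⌋₊ : ℝ) ≤ ∑ e, ((N : ℝ) + 1) * f e x :=
          Finset.sum_le_sum fun e _ => hfl e x
      _ = ((N : ℝ) + 1) * ∑ e, f e x := by rw [Finset.mul_sum]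
      _ ≤ N + 1 := by nlinarith [hf1 x]⟩
  have hρ : ∀ c, MeasurableSet[m] (ρ ⁻¹' {c}) := by
    intro c
    have : ρ ⁻¹' {c} = ⋂ e, (fun x => ⌊((N : ℝ) + 1) * f e x⌋₊) ⁻¹' {(c.1 e : ℕ)} := by
      ext x
      simp only [mem_preimage, mem_singleton_iff, mem_iInter]
      refine ⟨fun h e => by rw [← h], fun h => Subtype.ext (funext fun e => Fin.ext (h e))⟩
    rw [this]
    refine MeasurableSet.iInter fun e => ?_
    have h1 : Measurable[m] fun x => ((N : ℝ) + 1) * f e x := (hf e).const_mul _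
    exact (Nat.measurable_floor.comp h1) (measurableSet_singleton _)
  obtain ⟨Q, hQ, q0, q, g, hq, hqc, hg⟩ := exists_cell_approx μ B hB P hρ (half_pos hη)
  cases nonempty_fintype Q
  have hqm : ∀ i a, MeasurableSet[m] (q i ⁻¹' {a}) := by
    intro i a
    by_cases hP : P i
    · exact (le_iSup₂_of_le (f := fun i (_ : P i) => B i) i hP le_rfl : B i ≤ m) _ (hq i a)
    · rw [hqc i hP]
      exact @measurable_const _ _ ⊤ m q0 _ trivial
  let qh : X → ι → Q := fun x i => q i x
  have hqh : ∀ a, MeasurableSet[m] (qh ⁻¹' {a}) := fun a => measurableSet_fiber_pi hqm a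
  let F : (ι → Q) → D → ℝ := fun a e => ((g a).1 e : ℝ) / (N + 1)
  have hF0 : ∀ a e, 0 ≤ F a e := fun a e => by positivity
  have hF1 : ∀ a, ∑ e, F a e ≤ 1 := by
    intro a
    simp only [F, ← Finset.sum_div]
    exact div_le_one_of_le₀ (g a).2 hN0.le
  have hFm : ∀ e, Measurable[m] fun x => F (qh x) e := fun e =>
    measurable_apply_of_fibers (f := fun a _ => F a e) hqh fun _ => measurable_const
  let G : Set X := {x | ρ x = g (qh x)}
  have hG : MeasurableSet[m] G := by
    have : G = ⋃ a, qh ⁻¹' {a} ∩ ρ ⁻¹' {g a} := by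
      ext x
      simp [G]
    rw [this]
    exact MeasurableSet.iUnion fun a => (hqh a).inter (hρ _)
  have hGF : ∀ x ∈ G, ∀ e, F (qh x) e = (⌊((N : ℝ) + 1) * f e x⌋₊ : ℝ) / (N + 1) := by
    intro x hx e
    have hx' : ρ x = g (qh x) := hx
    simp only [F, ← hx', ρ]
  obtain ⟨t, ht, ht0, ht1, htS, hterr⟩ := exists_coupling hm hJ μ hd hf hf0 hfd qh F hF0 hF1 hFm G
    hG (1 / ((N : ℝ) + 1)) (by positivity)
    (by
      intro x hx e
      rw [hGF x hx e, div_le_iff₀ hN0, mul_comm (f e x)]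
      exact hfl e x)
    (by
      intro x hx e
      rw [hGF x hx e, sub_le_iff_le_add, ← add_div, le_div_iff₀ hN0, mul_comm (f e x), add_comm (1 : ℝ)]
      exact (Nat.lt_floor_add_one _).le)
  let F' : (ι → Q) → Option D → ℝ := fun a o => o.elim (1 - ∑ e, F a e) (F a)
  have hF'0 : ∀ a o, 0 ≤ F' a o := by
    rintro a (_ | e)
    · exact sub_nonneg.2 (hF1 a)
    · exact hF0 a e
  have hF'1 : ∀ a, ∑ o, F' a o = 1 := fun a => by simp [F', Fintype.sum_option]
  have ht1' : ∀ o x, t o x ≤ 1 := fun o x => by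
    rw [← ht1 x]
    exact Finset.single_le_sum (f := fun o => t o x) (fun i _ => ht0 i x) (Finset.mem_univ o)
  have hti : ∀ o, Integrable (t o) μ := fun o =>
    integrable_of_bounded ((ht o).mono hJ le_rfl) (K := 1) fun x => by
      rw [abs_of_nonneg (ht0 o x)]; exact ht1' o x
  have hFi : ∀ e, Integrable (fun x => F (qh x) e) μ := fun e =>
    integrable_of_bounded ((hFm e).mono (hm.trans hJ) le_rfl) (K := 1) fun x => by
      rw [abs_of_nonneg (hF0 _ _)]
      exact (Finset.single_le_sum (fun i _ => hF0 _ i) (Finset.mem_univ e)).trans (hF1 _)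
  have htS' : ∀ o (S : Set X), MeasurableSet[m] S →
      ∫ x in S, t o x ∂μ = ∫ x in S, F' (qh x) o ∂μ := by
    rintro (_ | e) S hS
    · have e1 : ∀ x, t none x = 1 - ∑ e, t (some e) x := fun x => by
        rw [← ht1 x, Fintype.sum_option]; ring
      simp only [e1, F', Option.elim]
      rw [integral_sub (integrable_const _)
          (integrable_finsetSum _ fun e _ => (hti (some e)).integrableOn),
        integral_sub (integrable_const _) (integrable_finsetSum _ fun e _ => (hFi e).integrableOn),
        integral_finsetSum _ fun e _ => (hti (some e)).integrableOn,
        integral_finsetSum _ fun e _ => (hFi e).integrableOn]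
      simp only [htS _ S hS]
    · exact htS e S hS
  let u : X → (ι → Q) → Option D → ℝ := fun x a o => if a = qh x then t o x else F' a o
  have hu0 : ∀ x a o, 0 ≤ u x a o := by
    intro x a o
    simp only [u]
    split_ifs
    · exact ht0 o x
    · exact hF'0 a o
  let v : ((ι → Q) → Option D) → X → ℝ := fun r x => ∏ a, u x a (r a)
  have hv0 : ∀ r x, 0 ≤ v r x := fun r x => Finset.prod_nonneg fun a _ => hu0 x a _
  have hv1 : ∀ x, ∑ r, v r x = 1 := by
    intro x
    refine sum_prod_eq_one _ fun a => ?_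
    by_cases h : a = qh x
    · simp [u, h, ht1]
    · simp [u, h, hF'1]
  let p : ((ι → Q) → Option D) → ℝ := fun r => ∏ a, F' a (r a)
  have hvm : ∀ r, Measurable[mJ] (v r) := by
    intro r
    refine Finset.measurable_prod _ fun a _ => ?_
    refine Measurable.ite ?_ (ht _) measurable_const
    have : {x | a = qh x} = qh ⁻¹' {a} := by
      ext x
      simp [eq_comm]
    rw [this]
    exact hm _ (hqh a)
  let d0 : D := Classical.arbitrary D
  refine ⟨Q, (ι → Q) → Option D, inferInstance, inferInstance, q0, q, v, p,
    fun r a => (r a).getD d0, hq, hqc, ⟨hvm, hv0, hv1, ?_⟩, ?_⟩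
  · intro r S hS
    have e1 : ∀ x, v r x = ∑ b, (qh ⁻¹' {b}).indicator
        (fun x => t (r b) x * ∏ a ∈ Finset.univ.erase b, F' a (r a)) x := by
      intro x
      rw [Finset.sum_eq_single (qh x)]
      · rw [indicator_of_mem (by simp)]
        simp only [v]
        rw [← Finset.mul_prod_erase _ _ (Finset.mem_univ (qh x))]
        congr 1
        · simp [u]
        · refine Finset.prod_congr rfl fun a ha => ?_
          simp [u, (Finset.mem_erase.1 ha).1]
      · intro b _ hb
        exact indicator_of_notMem (by simpa using fun h => hb h.symm) _
      · simp
    have hm0 : m ≤ m0 := hm.trans hJ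
    simp only [e1]
    rw [integral_finsetSum _ fun b _ =>
      ((((hti (r b)).mul_const _).indicator (hm0 _ (hqh b))).integrableOn)]
    have e2 : ∀ b, ∫ x in S, (qh ⁻¹' {b}).indicator
        (fun x => t (r b) x * ∏ a ∈ Finset.univ.erase b, F' a (r a)) x ∂μ =
        p r * μ.real (S ∩ qh ⁻¹' {b}) := by
      intro b
      rw [setIntegral_indicator (hm0 _ (hqh b)), integral_mul_const,
        htS' _ _ (hS.inter (hqh b))]
      have : ∫ x in S ∩ qh ⁻¹' {b}, F' (qh x) (r b) ∂μ = ∫ x in S ∩ qh ⁻¹' {b}, F' b (r b) ∂μ := by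
        refine setIntegral_congr_fun (hm0 _ (hS.inter (hqh b))) fun x hx => ?_
        have : qh x = b := hx.2
        simp [this]
      rw [this, setIntegral_const, smul_eq_mul]
      simp only [p]
      rw [← Finset.mul_prod_erase _ _ (Finset.mem_univ b)]
      ring
    simp only [e2]
    rw [← Finset.mul_sum]
    congr 1
    have := measureReal_biUnion_finset (μ := μ) (s := Finset.univ)
      (f := fun b => S ∩ qh ⁻¹' {b}) (by
        intro b _ b' _ hbb
        rw [Function.onFun, Set.disjoint_left]
        rintro x ⟨_, h1⟩ ⟨_, h2⟩
        exact hbb ((show qh x = b from h1).symm.trans h2))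
      (fun b _ => hm0 _ (hS.inter (hqh b)))
    rw [← this]
    congr 1
    ext x
    simp
  · have hle : ∀ x, (∑ r, if (r fun i => q i x).getD d0 = d x then 0 else v r x) ≤
        1 - t (some (d x)) x := by
      intro x
      have e1 : ∑ r : (ι → Q) → Option D, ∏ a,
          (if a = qh x then (if r a = some (d x) then t (r a) x else 0) else F' a (r a)) =
          t (some (d x)) x := by
        have := Finset.prod_univ_sum (fun _ : ι → Q => (Finset.univ : Finset (Option D)))
          (fun a o => if a = qh x then (if o = some (d x) then t o x else 0) else F' a o)
        rw [Fintype.piFinset_univ] at this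
        rw [← this, ← Finset.mul_prod_erase _ _ (Finset.mem_univ (qh x)),
          Finset.prod_eq_one]
        · simp
        · intro a ha
          simp [(Finset.mem_erase.1 ha).1, hF'1]
      rw [← e1, ← hv1 x, ← Finset.sum_sub_distrib]
      refine Finset.sum_le_sum fun r _ => ?_
      by_cases hr : r (qh x) = some (d x)
      · have h1 : (r fun i => q i x) = some (d x) := hr
        rw [if_pos (by rw [h1]; rfl)]
        refine sub_nonneg.2 (le_of_eq (Finset.prod_congr rfl fun a _ => ?_))
        by_cases ha : a = qh x
        · subst ha; simp [u, hr]
        · simp [u, ha]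
      · have e3 : ∏ a, (if a = qh x then (if r a = some (d x) then t (r a) x else 0)
            else F' a (r a)) = 0 := by
          refine Finset.prod_eq_zero (Finset.mem_univ (qh x)) ?_
          simp [hr]
        rw [e3, sub_zero]
        split_ifs
        · exact hv0 r x
        · exact le_rfl
    have hdm : ∀ e, MeasurableSet[m0] (d ⁻¹' {e}) := fun e => hJ _ (hd e)
    have hdt : Measurable[m0] fun x => t (some (d x)) x :=
      measurable_apply_of_fibers (f := fun e x => t (some e) x) hdm
        fun e => (ht _).mono hJ le_rfl
    have hi2 : Integrable (fun x => 1 - t (some (d x)) x) μ := by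
      refine integrable_of_bounded (K := 1) (measurable_const.sub hdt) fun x => ?_
      rw [abs_of_nonneg (sub_nonneg.2 (ht1' _ x))]
      linarith [ht0 (some (d x)) x]
    have hsum0 : ∀ x, 0 ≤ ∑ r, if (r fun i => q i x).getD d0 = d x then 0 else v r x := by
      intro x
      refine Finset.sum_nonneg fun r _ => ?_
      split_ifs
      · exact le_rfl
      · exact hv0 r x
    refine (integral_mono_of_nonneg (Filter.Eventually.of_forall hsum0) hi2
      (Filter.Eventually.of_forall hle)).trans (hterr.trans ?_)
    have hGc : μ.real Gᶜ ≤ η / 2 := by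
      refine le_of_eq_of_le ?_ hg
      congr 1
    linarith

/-- The σ-algebra generated by the σ-algebras attached to the proper subsets of `J`. -/
abbrev below {X W : Type} (B : Finset W → MeasurableSpace X) (J : Finset W) : MeasurableSpace X :=
  ⨆ J', ⨆ (_ : J' ⊂ J), B J'

theorem below_le {X W : Type} {B : Finset W → MeasurableSpace X} (hB : Monotone B)
    (J : Finset W) : below B J ≤ B J :=
  iSup₂_le fun _ h => hB h.subset

theorem sum_prod_mul_apply {A O : Type} [Fintype A] [DecidableEq A] [Fintype O] (u : A → O → ℝ)
    (hu : ∀ a, ∑ o, u a o = 1) (a₀ : A) (h : O → ℝ) :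
    ∑ r : A → O, (∏ a, u a (r a)) * h (r a₀) = ∑ o, u a₀ o * h o := by
  have := Finset.prod_univ_sum (fun _ : A => (Finset.univ : Finset O))
    (fun a o => u a o * if a = a₀ then h o else 1)
  rw [Fintype.piFinset_univ, ← Finset.mul_prod_erase _ _ (Finset.mem_univ a₀),
    Finset.prod_eq_one] at this
  · simp only [if_true, mul_one] at this
    rw [this]
    refine Finset.sum_congr rfl fun r _ => ?_
    rw [Finset.prod_mul_distrib]
    simp
  · intro a ha
    simp [(Finset.mem_erase.1 ha).1, hu]

theorem integrable_ite_fiber {X D : Type*} [DecidableEq D] [Countable D] {m0 : MeasurableSpace X}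
    {μ : Measure X} [IsFiniteMeasure μ] {e d : X → D} (he : ∀ a, MeasurableSet (e ⁻¹' {a}))
    (hd : ∀ a, MeasurableSet (d ⁻¹' {a})) {g : X → ℝ}
    (hg : Measurable g) (hg1 : ∀ x, |g x| ≤ 1) :
    Integrable (fun x => if e x = d x then 0 else g x) μ := by
  refine integrable_of_bounded (K := 1) (Measurable.ite ?_ measurable_const hg) fun x => ?_
  · have : {x | e x = d x} = ⋃ a, e ⁻¹' {a} ∩ d ⁻¹' {a} := by
      ext x
      simp [eq_comm]
    rw [this]
    exact MeasurableSet.iUnion fun a => (he a).inter (hd a)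
  · split_ifs
    · simp
    · exact hg1 x

theorem prod_abs_le_one {A : Type*} {s : Finset A} {u : A → ℝ} (hu : ∀ a, |u a| ≤ 1) :
    |∏ a ∈ s, u a| ≤ 1 := by
  rw [Finset.abs_prod]
  exact Finset.prod_le_one (fun a _ => abs_nonneg _) fun a _ => hu a

theorem IsWeight.const_mul {X C R : Type} [Fintype C] [Fintype R] {m0 : MeasurableSpace X}
    {μ : Measure X} [IsProbabilityMeasure μ] {m mJ : MeasurableSpace X} {w : C → X → ℝ}
    {p : C → ℝ} {v : R → X → ℝ} {pv : R → ℝ} (hw : IsWeight μ m mJ w p)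
    (hc : ∀ c x, w c x = p c) (hv : IsWeight μ m mJ v pv) :
    IsWeight μ m mJ (fun (cr : C × R) x => w cr.1 x * v cr.2 x) fun cr => p cr.1 * pv cr.2 where
  measurable cr := (hw.measurable _).mul (hv.measurable _)
  nonneg cr x := mul_nonneg (hw.nonneg _ _) (hv.nonneg _ _)
  sum_eq x := by
    rw [Fintype.sum_prod_type]
    simp only [← Finset.mul_sum, hv.sum_eq, mul_one, hw.sum_eq]
  setIntegral_eq cr S hS := by
    simp only [hc]
    rw [integral_const_mul, hv.setIntegral_eq _ S hS, mul_assoc]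

theorem IsWeight.mul_const {X C R : Type} [Fintype C] [Fintype R] {m0 : MeasurableSpace X}
    {μ : Measure X} [IsProbabilityMeasure μ] {m mJ : MeasurableSpace X} {w : C → X → ℝ}
    {p : C → ℝ} {v : R → X → ℝ} {pv : R → ℝ} (hw : IsWeight μ m mJ w p)
    (hv : IsWeight μ m mJ v pv) (hc : ∀ r x, v r x = pv r) :
    IsWeight μ m mJ (fun (cr : C × R) x => w cr.1 x * v cr.2 x) fun cr => p cr.1 * pv cr.2 where
  measurable cr := (hw.measurable _).mul (hv.measurable _)
  nonneg cr x := mul_nonneg (hw.nonneg _ _) (hv.nonneg _ _)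
  sum_eq x := by
    rw [Fintype.sum_prod_type]
    simp only [← Finset.mul_sum, hv.sum_eq, mul_one, hw.sum_eq]
  setIntegral_eq cr S hS := by
    simp only [hc]
    rw [integral_mul_const, hw.setIntegral_eq _ S hS]
    ring

theorem isWeight_single {X R : Type} [Fintype R] [DecidableEq R] {m0 : MeasurableSpace X}
    (μ : Measure X) [IsProbabilityMeasure μ] (m mJ : MeasurableSpace X) (r0 : R) :
    IsWeight μ m mJ (fun r _ => if r = r0 then 1 else 0) fun r => if r = r0 then 1 else 0 where
  measurable r := measurable_const
  nonneg r x := by split_ifs <;> norm_num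
  sum_eq x := by simp
  setIntegral_eq r S hS := by
    rw [setIntegral_const, smul_eq_mul, mul_comm]

theorem sum_arrow_prod {A C R : Type} [Fintype A] [DecidableEq A] [Fintype C] [Fintype R]
    (G : (A → C) → (A → R) → ℝ) :
    ∑ f : A → C × R, G (fun a => (f a).1) (fun a => (f a).2) = ∑ c, ∑ r, G c r := by
  rw [← Fintype.sum_prod_type']
  exact Fintype.sum_equiv (Equiv.arrowProdEquivProdArrow A (fun _ => C) (fun _ => R)) _ _
    fun f => rfl

theorem exists_weights_of_isLowerSet {X W : Type} [Fintype W] [DecidableEq W]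
    {m0 : MeasurableSpace X}
    (μ : Measure X) [IsProbabilityMeasure μ] (B : Finset W → MeasurableSpace X)
    (hB : ∀ J, B J ≤ m0) (hmono : Monotone B) (𝒥 : Finset (Finset W)) :
    IsLowerSet (𝒥 : Set (Finset W)) →
    ∀ (D : Type) [Fintype D] [Nonempty D] [DecidableEq D] (d : Finset W → X → D),
      (∀ J e, MeasurableSet[B J] (d J ⁻¹' {e})) → ∀ η : ℝ, 0 < η →
    ∃ (C : Type) (_ : Fintype C) (_ : Nonempty C) (w : Finset W → C → X → ℝ)
      (p : Finset W → C → ℝ) (T : Finset W → (Finset W → C) → D),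
      (∀ J, IsWeight μ (below B J) (B J) (w J) (p J)) ∧
      (∀ J, J ∉ 𝒥 → ∀ c x, w J c x = p J c) ∧
      ∀ J ∈ 𝒥, ∫ x, (∑ c, if T J c = d J x then 0 else ∏ J', w J' (c J') x) ∂μ ≤ η := by
  classical
  have hX : Nonempty X := μ.nonempty_of_neZero
  refine Finset.induction_on_max_value Finset.card 𝒥 ?_ ?_
  · intro _ D _ _ _ d _ η _
    refine ⟨Unit, inferInstance, inferInstance, _, _, fun _ _ => Classical.arbitrary D,
      fun J => isWeight_single μ _ _ (), fun _ _ _ _ => rfl, by simp⟩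
  · intro J 𝒥 hJ hmax ih hlow D _ _ _ d hd η hη
    have hlow' : IsLowerSet (𝒥 : Set (Finset W)) := by
      intro K L hLK hK
      have h1 : L ∈ insert J 𝒥 := by
        have := hlow hLK (a := K) (by simp [Finset.mem_coe.1 hK])
        simpa using this
      rcases Finset.mem_insert.1 h1 with rfl | h
      · have := Finset.eq_of_subset_of_card_le hLK (hmax K hK)
        rw [this]
        exact hK
      · exact h
    have hsub : ∀ J', J' ⊂ J → J' ∈ 𝒥 := by
      intro J' hJ'
      have h1 : J' ∈ (↑(insert J 𝒥) : Set (Finset W)) := hlow hJ'.subset (by simp)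
      have h2 : J' ∈ insert J 𝒥 := h1
      exact (Finset.mem_insert.1 h2).resolve_left hJ'.ne
    obtain ⟨Q, R, _, _, q0, q, v, pv, Tv, hq, hqc, hv, hverr⟩ :=
      exists_response μ B hB (fun J' => J' ⊂ J) (below_le hmono J) (hB J) (hd J) (half_pos hη)
    let N : ℝ := Fintype.card (Finset W)
    have hN : 0 < N := by
      have : 0 < Fintype.card (Finset W) := Fintype.card_pos
      simp only [N]
      exact_mod_cast this
    have hQ : Nonempty Q := ⟨q0⟩
    have hN1 : 1 ≤ N := by
      have : 0 < Fintype.card (Finset W) := Fintype.card_pos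
      simp only [N]
      exact_mod_cast this
    obtain ⟨C, _, _, w, p, T, hw, hwc, herr⟩ := ih hlow' (D × Q) (fun J x => (d J x, q J x))
      (by
        rintro K ⟨e, a⟩
        have : (fun x => (d K x, q K x)) ⁻¹' {(e, a)} = d K ⁻¹' {e} ∩ q K ⁻¹' {a} := by
          ext x
          simp
        rw [this]
        exact (hd K e).inter (hq K a))
      (η / (2 * N)) (by positivity)
    have hR : Nonempty R := by
      by_contra h
      rw [not_nonempty_iff] at h
      have := hv.sum_eq (Classical.arbitrary X)
      simp at this
    let r0 : R := Classical.arbitrary R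
    let v' : Finset W → R → X → ℝ := fun K => if K = J then v else
      fun r _ => if r = r0 then 1 else 0
    let pv' : Finset W → R → ℝ := fun K => if K = J then pv else
      fun r => if r = r0 then 1 else 0
    have hv' : ∀ K, IsWeight μ (below B K) (B K) (v' K) (pv' K) := by
      intro K
      by_cases h : K = J
      · subst h
        simp only [v', pv', if_true]
        exact hv
      · simp only [v', pv', h, if_false]
        exact isWeight_single μ _ _ r0
    have hv'c : ∀ K, K ≠ J → ∀ r x, v' K r x = pv' K r := by
      intro K h r x
      simp [v', pv', h]
    let Tn : Finset W → (Finset W → C × R) → D := fun K f =>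
      if K = J then Tv (f J).2 (fun J' => if J' ⊂ J then (T J' fun L => (f L).1).2 else q0)
      else (T K fun L => (f L).1).1
    let Wc : (Finset W → C) → X → ℝ := fun c x => ∏ K, w K (c K) x
    let Vr : (Finset W → R) → X → ℝ := fun r x => ∏ K, v' K (r K) x
    have hWc0 : ∀ c x, 0 ≤ Wc c x := fun c x => Finset.prod_nonneg fun K _ => (hw K).nonneg _ _
    have hVr0 : ∀ r x, 0 ≤ Vr r x := fun r x => Finset.prod_nonneg fun K _ => (hv' K).nonneg _ _
    have hWc1 : ∀ x, ∑ c, Wc c x = 1 := fun x => sum_prod_eq_one (fun K c => w K c x)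
      fun K => (hw K).sum_eq x
    have hVr1 : ∀ x, ∑ r, Vr r x = 1 := fun x => sum_prod_eq_one (fun K c => v' K c x)
      fun K => (hv' K).sum_eq x
    let err : Finset W → X → ℝ := fun K x =>
      ∑ c, if T K c = (d K x, q K x) then 0 else Wc c x
    have herri : ∀ K, Integrable (err K) μ := by
      intro K
      refine integrable_finsetSum _ fun c _ => ?_
      refine integrable_ite_fiber (e := fun _ => T K c) (d := fun x => (d K x, q K x))
        (fun a => @measurable_const _ _ ⊤ m0 (T K c) _ trivial) ?_ ?_ ?_
      · rintro ⟨e, a⟩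
        have : (fun x => (d K x, q K x)) ⁻¹' {(e, a)} = d K ⁻¹' {e} ∩ q K ⁻¹' {a} := by
          ext x
          simp
        rw [this]
        exact ((hB K) _ (hd K e)).inter ((hB K) _ (hq K a))
      · exact Finset.measurable_prod _ fun L _ => ((hw L).measurable _).mono (hB L) le_rfl
      · exact fun x => prod_abs_le_one fun L => (hw L).abs_le_one _ _
    have herr0 : ∀ K x, 0 ≤ err K x := fun K x => Finset.sum_nonneg fun c _ => by
      split_ifs
      · exact le_rfl
      · exact hWc0 c x
    refine ⟨C × R, inferInstance, inferInstance, fun K cr x => w K cr.1 x * v' K cr.2 x,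
      fun K cr => p K cr.1 * pv' K cr.2, Tn, ?_, ?_, ?_⟩
    · intro K
      by_cases h : K = J
      · exact (hw K).const_mul (hwc K (h ▸ hJ)) (hv' K)
      · exact (hw K).mul_const (hv' K) (hv'c K h)
    · intro K hK c x
      rw [Finset.mem_insert, not_or] at hK
      change w K c.1 x * v' K c.2 x = _
      rw [hwc K hK.2, hv'c K hK.1]
    · have hsplit : ∀ f : Finset W → C × R, ∀ x, ∏ K, (w K (f K).1 x * v' K (f K).2 x) =
          Wc (fun L => (f L).1) x * Vr (fun L => (f L).2) x := fun f x =>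
        Finset.prod_mul_distrib
      simp only [hsplit]
      have hnonneg : ∀ K x, 0 ≤ ∑ f, if Tn K f = d K x then 0 else
          Wc (fun L => (f L).1) x * Vr (fun L => (f L).2) x := fun K x =>
        Finset.sum_nonneg fun f _ => by
          split_ifs
          · exact le_rfl
          · exact mul_nonneg (hWc0 _ _) (hVr0 _ _)
      intro K hK
      by_cases hKJ : K = J
      · subst hKJ
        let errv : X → ℝ := fun x => ∑ r, if Tv r (fun i => q i x) = d K x then 0 else v r x
        have hv'K : v' K = v := by simp [v']
        have hle : ∀ x, (∑ f, if Tn K f = d K x then 0 else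
            Wc (fun L => (f L).1) x * Vr (fun L => (f L).2) x) ≤
            ∑ J' ∈ Finset.univ.filter (· ⊂ K), err J' x + errv x := by
          intro x
          have e1 : ∀ J', err J' x = ∑ f : Finset W → C × R,
              (if T J' (fun L => (f L).1) = (d J' x, q J' x) then 0 else Wc (fun L => (f L).1) x) *
                Vr (fun L => (f L).2) x := by
            intro J'
            rw [sum_arrow_prod (fun c r =>
              (if T J' c = (d J' x, q J' x) then 0 else Wc c x) * Vr r x)]
            simp only [← Finset.mul_sum, hVr1, mul_one, err]
          have e2 : errv x = ∑ f : Finset W → C × R, Wc (fun L => (f L).1) x *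
              (Vr (fun L => (f L).2) x *
                if Tv (f K).2 (fun i => q i x) = d K x then 0 else 1) := by
            rw [sum_arrow_prod (fun c r => Wc c x * (Vr r x *
                if Tv (r K) (fun i => q i x) = d K x then 0 else 1))]
            have := sum_prod_mul_apply (fun K r => v' K r x) (fun K => (hv' K).sum_eq x) K
              (fun r => if Tv r (fun i => q i x) = d K x then 0 else 1)
            simp only [← Finset.mul_sum]
            rw [← Finset.sum_mul, hWc1, one_mul]
            refine Eq.trans ?_ this.symm
            simp [errv, hv'K]
          simp only [e1]
          rw [e2, Finset.sum_comm, ← Finset.sum_add_distrib]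
          refine Finset.sum_le_sum fun f _ => ?_
          have hWV := mul_nonneg (hWc0 (fun L => (f L).1) x) (hVr0 (fun L => (f L).2) x)
          have hsum0 : 0 ≤ ∑ J' ∈ Finset.univ.filter (· ⊂ K),
              (if T J' (fun L => (f L).1) = (d J' x, q J' x) then 0 else
                Wc (fun L => (f L).1) x) * Vr (fun L => (f L).2) x := by
            refine Finset.sum_nonneg fun J' _ => mul_nonneg ?_ (hVr0 _ _)
            split_ifs
            · exact le_rfl
            · exact hWc0 _ _
          have hlast0 : 0 ≤ Wc (fun L => (f L).1) x * (Vr (fun L => (f L).2) x *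
                if Tv (f K).2 (fun i => q i x) = d K x then 0 else 1) := by
            split_ifs
            · simp
            · simpa using hWV
          by_cases hT : Tn K f = d K x
          · rw [if_pos hT]
            exact add_nonneg hsum0 hlast0
          rw [if_neg hT]
          by_cases hall : ∀ J', J' ⊂ K → T J' (fun L => (f L).1) = (d J' x, q J' x)
          · have : (fun J' => if J' ⊂ K then (T J' fun L => (f L).1).2 else q0) =
                fun i => q i x := by
              funext J'
              by_cases hJ' : J' ⊂ K
              · simp [hJ', hall J' hJ']
              · simp [hJ', hqc J' hJ']
            have hT' : ¬ Tv (f K).2 (fun i => q i x) = d K x := by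
              intro h
              apply hT
              simp only [Tn, if_true]
              rw [this]
              exact h
            rw [if_neg hT', mul_one]
            linarith
          · push Not at hall
            obtain ⟨J', hJ', hne⟩ := hall
            have h1 := Finset.single_le_sum (f := fun J' =>
              (if T J' (fun L => (f L).1) = (d J' x, q J' x) then 0 else
                Wc (fun L => (f L).1) x) * Vr (fun L => (f L).2) x)
              (s := Finset.univ.filter (· ⊂ K))
              (by
                intro J' _
                refine mul_nonneg ?_ (hVr0 _ _)
                split_ifs
                · exact le_rfl
                · exact hWc0 _ _) (by simp [hJ'] : J' ∈ _)
            simp only [hne, if_false] at h1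
            linarith
        have herrvi : Integrable errv μ := by
          refine integrable_finsetSum _ fun r _ => ?_
          exact integrable_ite_fiber (e := fun x => Tv r fun i => q i x) (fun a =>
              measurableSet_preimage_of_fibers
                (measurableSet_fiber_pi fun i a => hB i _ (hq i a)) (Tv r ⁻¹' {a}))
            (fun e => hB K _ (hd K e)) ((hv.measurable r).mono (hB K) le_rfl) fun x => hv.abs_le_one _ _
        calc _ ≤ ∫ x, (∑ J' ∈ Finset.univ.filter (· ⊂ K), err J' x + errv x) ∂μ :=
              integral_mono_of_nonneg (Filter.Eventually.of_forall (hnonneg K))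
                ((integrable_finsetSum _ fun J' _ => herri J').add herrvi)
                (Filter.Eventually.of_forall hle)
          _ = ∑ J' ∈ Finset.univ.filter (· ⊂ K), ∫ x, err J' x ∂μ + ∫ x, errv x ∂μ := by
              rw [integral_add (integrable_finsetSum _ fun J' _ => herri J') herrvi,
                integral_finsetSum _ fun J' _ => herri J']
          _ ≤ ∑ J' ∈ Finset.univ.filter (· ⊂ K), η / (2 * N) + η / 2 := by
              refine add_le_add (Finset.sum_le_sum fun J' hJ' => ?_) hverr
              exact herr J' (hsub J' (by simpa using hJ'))
          _ ≤ N * (η / (2 * N)) + η / 2 := by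
              rw [Finset.sum_const, nsmul_eq_mul]
              gcongr
              simp only [N]
              exact_mod_cast Finset.card_le_univ _
          _ = η := by field_simp; ring
      · have hK' : K ∈ 𝒥 := (Finset.mem_insert.1 hK).resolve_left hKJ
        have hle : ∀ x, (∑ f, if Tn K f = d K x then 0 else
            Wc (fun L => (f L).1) x * Vr (fun L => (f L).2) x) ≤ err K x := by
          intro x
          have e1 : err K x = ∑ f : Finset W → C × R,
              (if T K (fun L => (f L).1) = (d K x, q K x) then 0 else Wc (fun L => (f L).1) x) *
                Vr (fun L => (f L).2) x := by
            rw [sum_arrow_prod (fun c r =>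
              (if T K c = (d K x, q K x) then 0 else Wc c x) * Vr r x)]
            simp only [← Finset.mul_sum, hVr1, mul_one, err]
          rw [e1]
          refine Finset.sum_le_sum fun f _ => ?_
          have hWV := mul_nonneg (hWc0 (fun L => (f L).1) x) (hVr0 (fun L => (f L).2) x)
          by_cases h : T K (fun L => (f L).1) = (d K x, q K x)
          · have : Tn K f = d K x := by simp [Tn, hKJ, h]
            simp [this, h]
          · rw [if_neg h]
            split_ifs
            · exact hWV
            · exact le_rfl
        refine (integral_mono_of_nonneg (Filter.Eventually.of_forall (hnonneg K)) (herri K)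
          (Filter.Eventually.of_forall hle)).trans ((herr K hK').trans ?_)
        rw [div_le_iff₀ (by positivity)]
        nlinarith

theorem integral_mul_condExp_eq {X : Type*} {m m0 : MeasurableSpace X} (hm : m ≤ m0)
    {μ : Measure X} [IsProbabilityMeasure μ] {g f : X → ℝ} {K L : ℝ} (hg : Measurable[m] g)
    (hK : ∀ x, |g x| ≤ K) (hf : Measurable[m0] f) (hL : ∀ x, |f x| ≤ L) :
    ∫ x, g x * f x ∂μ = ∫ x, g x * (μ[f|m]) x ∂μ := by
  have hfi : Integrable f μ := integrable_of_bounded hf hL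
  have hgf : Integrable (g * f) μ :=
    integrable_of_bounded ((hg.mono hm le_rfl).mul hf) (K := K * L) fun x => by
      rw [Pi.mul_apply, abs_mul]
      exact mul_le_mul (hK x) (hL x) (abs_nonneg _) ((abs_nonneg _).trans (hK x))
  have h := condExp_mul_of_stronglyMeasurable_left (m := m) (μ := μ) hg.stronglyMeasurable hgf hfi
  calc ∫ x, g x * f x ∂μ = ∫ x, (μ[g * f|m]) x ∂μ := (integral_condExp hm).symm
    _ = ∫ x, g x * (μ[f|m]) x ∂μ := integral_congr_ae h

theorem integral_mul_eq_of_setIntegral_eq {X : Type*} {m m0 : MeasurableSpace X} (hm : m ≤ m0)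
    {μ : Measure X} [IsProbabilityMeasure μ] {g f : X → ℝ} {K L p : ℝ} (hg : Measurable[m] g)
    (hK : ∀ x, |g x| ≤ K) (hf : Measurable[m0] f) (hL : ∀ x, |f x| ≤ L)
    (hp : ∀ S, MeasurableSet[m] S → ∫ x in S, f x ∂μ = p * μ.real S) :
    ∫ x, g x * f x ∂μ = p * ∫ x, g x ∂μ := by
  have hfi : Integrable f μ := integrable_of_bounded hf hL
  have hc : (fun _ => p) =ᵐ[μ] μ[f|m] := by
    refine ae_eq_condExp_of_forall_setIntegral_eq hm hfi
      (fun S _ _ => (integrable_const _).integrableOn) (fun S hS _ => ?_)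
      (@measurable_const _ _ _ m p).stronglyMeasurable.aestronglyMeasurable
    rw [hp S hS, setIntegral_const, smul_eq_mul, mul_comm]
  rw [integral_mul_condExp_eq hm hg hK hf hL, ← integral_const_mul]
  refine integral_congr_ae ?_
  filter_upwards [hc] with x hx
  rw [← hx, mul_comm]

/-- A measurable choice from a finite set which does at least as well as a random choice. -/
theorem exists_choice_integral_le {X C : Type} {m m0 : MeasurableSpace X} (hm : m ≤ m0)
    (μ : Measure X) [IsProbabilityMeasure μ] [Fintype C] [Nonempty C] [DecidableEq C]
    {w H : C → X → ℝ} (hw : ∀ c, Measurable[m] (w c)) (hw0 : ∀ c x, 0 ≤ w c x)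
    (hw1 : ∀ x, ∑ c, w c x = 1) {L : ℝ} (hH : ∀ c, Measurable[m0] (H c))
    (hL : ∀ c x, |H c x| ≤ L) :
    ∃ γ : X → C, (∀ c, MeasurableSet[m] (γ ⁻¹' {c})) ∧
      ∫ x, (∑ c, (if γ x = c then 1 else 0) * H c x) ∂μ ≤ ∫ x, (∑ c, w c x * H c x) ∂μ := by
  classical
  let G : C → X → ℝ := fun c => μ[H c|m]
  have hG : ∀ c, Measurable[m] (G c) := fun c => stronglyMeasurable_condExp.measurable
  have hGi : ∀ c, Integrable (G c) μ := fun c => integrable_condExp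
  have hw1' : ∀ c x, |w c x| ≤ 1 := fun c x => by
    rw [abs_of_nonneg (hw0 c x), ← hw1 x]
    exact Finset.single_le_sum (f := fun c => w c x) (fun i _ => hw0 i x) (Finset.mem_univ c)
  let τ : C → X → Prop := fun c x => ∀ b, G c x ≤ G b x
  have hτ : ∀ c a, MeasurableSet[m] (τ c ⁻¹' {a}) := by
    intro c a
    have h1 : MeasurableSet[m] {x | ∀ b, G c x ≤ G b x} := by
      have : {x | ∀ b, G c x ≤ G b x} = ⋂ b, {x | G c x ≤ G b x} := by
        ext x
        simp
      rw [this]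
      exact MeasurableSet.iInter fun b => measurableSet_le (hG c) (hG b)
    by_cases ha : a
    · have : τ c ⁻¹' {a} = {x | ∀ b, G c x ≤ G b x} := by
        ext x
        simp [τ, ha]
      rw [this]
      exact h1
    · have : τ c ⁻¹' {a} = {x | ∀ b, G c x ≤ G b x}ᶜ := by
        ext x
        simp [τ, ha]
      rw [this]
      exact h1.compl
  let sel : (C → Prop) → C := fun t => if h : ∃ c, t c then h.choose else Classical.arbitrary C
  let γ : X → C := fun x => sel fun c => τ c x
  have hγ : ∀ c, MeasurableSet[m] (γ ⁻¹' {c}) := fun c =>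
    measurableSet_preimage_of_fibers (measurableSet_fiber_pi hτ) (sel ⁻¹' {c})
  have hmin : ∀ x b, G (γ x) x ≤ G b x := by
    intro x
    have hex : ∃ c, τ c x := by
      obtain ⟨c, _, hc⟩ := Finset.exists_min_image Finset.univ (fun c => G c x)
        Finset.univ_nonempty
      exact ⟨c, fun b => hc b (Finset.mem_univ b)⟩
    have : γ x = hex.choose := dif_pos hex
    rw [this]
    exact hex.choose_spec
  have hind : ∀ c, Measurable[m] fun x => if γ x = c then (1 : ℝ) else 0 := fun c =>
    Measurable.ite (hγ c) measurable_const measurable_const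
  have hind1 : ∀ c x, |if γ x = c then (1 : ℝ) else 0| ≤ 1 := fun c x => by
    split_ifs <;> simp
  have hint : ∀ (u : C → X → ℝ), (∀ c, Measurable[m] (u c)) → (∀ c x, |u c x| ≤ 1) →
      (∀ c, Integrable (fun x => u c x * G c x) μ) ∧
      ∫ x, (∑ c, u c x * H c x) ∂μ = ∫ x, (∑ c, u c x * G c x) ∂μ := by
    intro u hu hu1
    have hi : ∀ c, Integrable (fun x => u c x * G c x) μ := fun c =>
      (hGi c).bdd_mul ((hu c).mono hm le_rfl).aestronglyMeasurable
        (Filter.Eventually.of_forall (hu1 c))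
    refine ⟨hi, ?_⟩
    rw [integral_finsetSum _ fun c _ => hi c, integral_finsetSum]
    · exact Finset.sum_congr rfl fun c _ => integral_mul_condExp_eq hm (hu c) (hu1 c) (hH c) (hL c)
    · intro c _
      exact (integrable_of_bounded (hH c) (hL c)).bdd_mul
        ((hu c).mono hm le_rfl).aestronglyMeasurable (Filter.Eventually.of_forall (hu1 c))
  obtain ⟨hi1, he1⟩ := hint _ hind hind1
  obtain ⟨hi2, he2⟩ := hint _ hw hw1'
  refine ⟨γ, hγ, ?_⟩
  rw [he1, he2]
  refine integral_mono (integrable_finsetSum _ fun c _ => hi1 c)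
    (integrable_finsetSum _ fun c _ => hi2 c) fun x => ?_
  calc ∑ c, (if γ x = c then (1 : ℝ) else 0) * G c x = G (γ x) x := by simp
    _ = ∑ c, w c x * G (γ x) x := by rw [← Finset.sum_mul, hw1, one_mul]
    _ ≤ ∑ c, w c x * G c x := by
        gcongr with c _
        · exact hw0 c x
        · exact hmin x c

theorem exists_selection {X ι C : Type} [Fintype ι] [DecidableEq ι] {m0 : MeasurableSpace X}
    (μ : Measure X) [IsProbabilityMeasure μ] (B : ι → MeasurableSpace X) (hB : ∀ J, B J ≤ m0)
    [Fintype C] [Nonempty C] [DecidableEq C] {w : ι → C → X → ℝ}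
    (hw : ∀ J c, Measurable[B J] (w J c)) (hw0 : ∀ J c x, 0 ≤ w J c x)
    (hw1 : ∀ J x, ∑ c, w J c x = 1) {h : (ι → C) → X → ℝ} (hh : ∀ c, Measurable[m0] (h c))
    {L : ℝ} (hL : ∀ c x, |h c x| ≤ L) :
    ∃ γ : ι → X → C, (∀ J c, MeasurableSet[B J] (γ J ⁻¹' {c})) ∧
      ∫ x, h (fun J => γ J x) x ∂μ ≤ ∫ x, (∑ c, h c x * ∏ J, w J (c J) x) ∂μ := by
  classical
  have hX : Nonempty X := μ.nonempty_of_neZero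
  have key : ∀ S : Finset ι, ∃ (u : ι → C → X → ℝ) (γ : ι → X → C),
      (∀ J c, Measurable[B J] (u J c)) ∧ (∀ J c x, 0 ≤ u J c x) ∧ (∀ J x, ∑ c, u J c x = 1) ∧
      (∀ J c, MeasurableSet[B J] (γ J ⁻¹' {c})) ∧
      (∀ J ∈ S, ∀ c x, u J c x = if γ J x = c then 1 else 0) ∧
      ∫ x, (∑ c, h c x * ∏ J, u J (c J) x) ∂μ ≤ ∫ x, (∑ c, h c x * ∏ J, w J (c J) x) ∂μ := by
    intro S
    induction S using Finset.induction_on with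
    | empty =>
      exact ⟨w, fun _ _ => Classical.arbitrary C, hw, hw0, hw1,
        fun J c => @measurable_const _ _ ⊤ (B J) _ _ trivial, by simp, le_rfl⟩
    | insert J S hJ ih =>
      obtain ⟨u, γ, hu, hu0, hu1, hγ, hγu, hle⟩ := ih
      have hu1' : ∀ J c x, |u J c x| ≤ 1 := fun J c x => by
        rw [abs_of_nonneg (hu0 J c x), ← hu1 J x]
        exact Finset.single_le_sum (f := fun c => u J c x) (fun i _ => hu0 J i x)
          (Finset.mem_univ c)
      let H : C → X → ℝ := fun a x =>
        ∑ c, if c J = a then h c x * ∏ K ∈ Finset.univ.erase J, u K (c K) x else 0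
      have hH : ∀ a, Measurable[m0] (H a) := by
        intro a
        refine Finset.measurable_sum _ fun c _ => ?_
        split_ifs
        · exact (hh c).mul (Finset.measurable_prod _ fun K _ => (hu K _).mono (hB K) le_rfl)
        · exact measurable_const
      have hL0 : 0 ≤ L := (abs_nonneg _).trans
        (hL (fun _ => Classical.arbitrary C) (Classical.arbitrary X))
      have hHL : ∀ a x, |H a x| ≤ ∑ _c : ι → C, L := by
        intro a x
        refine (Finset.abs_sum_le_sum_abs _ _).trans (Finset.sum_le_sum fun c _ => ?_)
        split_ifs
        · rw [abs_mul]
          calc |h c x| * |∏ K ∈ Finset.univ.erase J, u K (c K) x| ≤ L * 1 :=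
                mul_le_mul (hL c x) (prod_abs_le_one fun K => hu1' K _ x) (abs_nonneg _) hL0
            _ = L := mul_one L
        · simpa using hL0
      have hsplit : ∀ (t : C → X → ℝ) (x : X), ∑ a, t a x * H a x =
          ∑ c, h c x * ∏ K, (Function.update u J t) K (c K) x := by
        intro t x
        simp only [H, Finset.mul_sum]
        rw [Finset.sum_comm]
        refine Finset.sum_congr rfl fun c _ => ?_
        simp only [mul_ite, mul_zero, Finset.sum_ite_eq, Finset.mem_univ, if_true]
        rw [← Finset.mul_prod_erase _ _ (Finset.mem_univ J), Function.update_self]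
        have : ∏ K ∈ Finset.univ.erase J, Function.update u J t K (c K) x =
            ∏ K ∈ Finset.univ.erase J, u K (c K) x :=
          Finset.prod_congr rfl fun K hK => by
            rw [Function.update_of_ne (Finset.mem_erase.1 hK).1]
        rw [this]
        ring
      obtain ⟨g, hg, hgle⟩ := exists_choice_integral_le (hB J) μ (hu J) (hu0 J) (hu1 J) hH hHL
      have e1 := fun x => hsplit (fun a x => if g x = a then 1 else 0) x
      have e2 := hsplit (u J)
      rw [Function.update_eq_self] at e2
      simp only [e1, e2] at hgle
      refine ⟨Function.update u J (fun a x => if g x = a then 1 else 0), Function.update γ J g,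
        ?_, ?_, ?_, ?_, ?_, hgle.trans hle⟩
      · intro K c
        by_cases hK : K = J
        · subst hK
          rw [Function.update_self]
          exact Measurable.ite (hg c) measurable_const measurable_const
        · rw [Function.update_of_ne hK]
          exact hu K c
      · intro K c x
        by_cases hK : K = J
        · subst hK
          rw [Function.update_self]
          split_ifs <;> norm_num
        · rw [Function.update_of_ne hK]
          exact hu0 K c x
      · intro K x
        by_cases hK : K = J
        · subst hK
          simp
        · rw [Function.update_of_ne hK]
          exact hu1 K x
      · intro K c
        by_cases hK : K = J
        · subst hK
          rw [Function.update_self]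
          exact hg c
        · rw [Function.update_of_ne hK]
          exact hγ K c
      · intro K hKS c x
        by_cases hK : K = J
        · subst hK
          simp
        · rw [Function.update_of_ne hK, Function.update_of_ne hK]
          exact hγu K ((Finset.mem_insert.1 hKS).resolve_left hK) c x
  obtain ⟨u, γ, -, -, -, hγ, hγu, hle⟩ := key Finset.univ
  refine ⟨γ, hγ, le_of_eq_of_le (integral_congr_ae (Filter.Eventually.of_forall fun x => ?_)) hle⟩
  dsimp only
  rw [Finset.sum_eq_single (fun J => γ J x)]
  · rw [Finset.prod_eq_one, mul_one]
    intro J _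
    rw [hγu J (Finset.mem_univ J), if_pos rfl]
  · intro c _ hc
    obtain ⟨J, hJ⟩ := Function.ne_iff.1 hc
    rw [Finset.prod_eq_zero (Finset.mem_univ J), mul_zero]
    rw [hγu J (Finset.mem_univ J), if_neg fun h => hJ h.symm]
  · simp

/-- Conditional independence: the weights attached to `J` are independent of everything
determined by the index sets not containing `J`. -/
def IsIndependent {X W C : Type} {m0 : MeasurableSpace X} (μ : Measure X)
    (B : Finset W → MeasurableSpace X) (w : Finset W → C → X → ℝ) (p : Finset W → C → ℝ) : Prop :=
  ∀ J c S, MeasurableSet[⨆ J', ⨆ (_ : ¬ J ⊆ J'), B J'] S →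
    ∫ x in S, w J c x ∂μ = p J c * μ.real S

theorem integral_mul_prod_weights {X W C : Type} [Fintype C] {m0 : MeasurableSpace X}
    (μ : Measure X) [IsProbabilityMeasure μ] (B : Finset W → MeasurableSpace X)
    (hB : ∀ J, B J ≤ m0) {w : Finset W → C → X → ℝ} {p : Finset W → C → ℝ}
    (hw : ∀ J, IsWeight μ (below B J) (B J) (w J) (p J)) (hind : IsIndependent μ B w p)
    (c : Finset W → C) {g : X → ℝ} {K : ℝ} (hK : ∀ x, |g x| ≤ K) (Δ : Finset (Finset W)) :
    (∀ J ∈ Δ, Measurable[⨆ J', ⨆ (_ : ¬ J ⊆ J'), B J'] g) →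
    ∫ x, g x * ∏ J ∈ Δ, w J (c J) x ∂μ = (∏ J ∈ Δ, p J (c J)) * ∫ x, g x ∂μ := by
  classical
  refine Finset.induction_on_max_value Finset.card Δ ?_ ?_
  · simp
  · intro J Δ hJ hmax ih hg
    have hK0 : 0 ≤ K := by
      have hX : Nonempty X := μ.nonempty_of_neZero
      exact (abs_nonneg _).trans (hK (Classical.arbitrary X))
    have hle : ⨆ J', ⨆ (_ : ¬ J ⊆ J'), B J' ≤ m0 := iSup₂_le fun J' _ => hB J'
    rw [Finset.prod_insert hJ, mul_assoc, ← ih fun J' hJ' => hg J' (Finset.mem_insert_of_mem hJ')]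
    have hm : Measurable[⨆ J', ⨆ (_ : ¬ J ⊆ J'), B J'] fun x => g x * ∏ J ∈ Δ, w J (c J) x := by
      refine (hg J (Finset.mem_insert_self _ _)).mul (Finset.measurable_prod _ fun J' hJ' => ?_)
      refine ((hw J').measurable _).mono ?_ le_rfl
      refine le_iSup₂_of_le (f := fun J' (_ : ¬ J ⊆ J') => B J') J' ?_ le_rfl
      intro hsub
      have := Finset.eq_of_subset_of_card_le hsub (hmax J' hJ')
      exact hJ (this ▸ hJ')
    rw [← integral_mul_eq_of_setIntegral_eq hle hm (K := K) (L := 1) ?_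
      (((hw J).measurable (c J)).mono (hB J) le_rfl) ((hw J).abs_le_one _) (hind J (c J))]
    · refine integral_congr_ae (Filter.Eventually.of_forall fun x => ?_)
      dsimp only
      rw [Finset.prod_insert hJ]
      ring
    · intro x
      rw [abs_mul]
      calc |g x| * |∏ J ∈ Δ, w J (c J) x| ≤ K * 1 :=
            mul_le_mul (hK x) (prod_abs_le_one fun J => (hw J).abs_le_one _ x) (abs_nonneg _) hK0
        _ = K := mul_one K

theorem exists_good_configurations {X W : Type} [Fintype W] [DecidableEq W]
    {m0 : MeasurableSpace X} (μ : Measure X) [IsProbabilityMeasure μ]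
    (B : Finset W → MeasurableSpace X) (hB : ∀ J, B J ≤ m0) (hmono : Monotone B)
    (hind : ∀ (J : Finset W) (w : X → ℝ) (p : ℝ), Measurable[B J] w → (∀ x, |w x| ≤ 1) →
      (∀ S, MeasurableSet[below B J] S → ∫ x in S, w x ∂μ = p * μ.real S) →
      ∀ S, MeasurableSet[⨆ J', ⨆ (_ : ¬ J ⊆ J'), B J'] S → ∫ x in S, w x ∂μ = p * μ.real S)
    (F : Finset (Finset W)) (E : Finset W → Set X) (hE : ∀ I ∈ F, MeasurableSet[B I] (E I))
    (hnull : μ (⋂ I ∈ F, E I) = 0) {ε : ℝ} (hε : 0 < ε) :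
    ∃ (C : Type) (_ : Fintype C) (_ : Nonempty C) (γ : Finset W → X → C)
      (Good : Finset W → Set (Finset W → C)),
      (∀ J c, MeasurableSet[B J] (γ J ⁻¹' {c})) ∧
      (∀ I c c', (∀ J ⊆ I, c J = c' J) → c ∈ Good I → c' ∈ Good I) ∧
      (∀ c, ∃ I ∈ F, c ∉ Good I) ∧
      ∀ I ∈ F, μ.real (E I ∩ {x | (fun J => γ J x) ∉ Good I}) ≤ ε := by
  classical
  let n : ℝ := F.card
  have hn0 : 0 ≤ n := by positivity
  let d : Finset W → X → Bool := fun J x => decide (J ∈ F ∧ x ∈ E J)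
  have hd : ∀ J e, MeasurableSet[B J] (d J ⁻¹' {e}) := by
    intro J e
    by_cases hJ : J ∈ F
    · cases e
      · have : d J ⁻¹' {false} = (E J)ᶜ := by
          ext x
          simp [d, hJ]
        rw [this]
        exact (hE J hJ).compl
      · have : d J ⁻¹' {true} = E J := by
          ext x
          simp [d, hJ]
        rw [this]
        exact hE J hJ
    · have : d J = fun _ => false := by
        funext x
        simp [d, hJ]
      rw [this]
      exact @measurable_const _ _ ⊤ (B J) _ _ trivial
  obtain ⟨C, _, _, w, p, T, hw, -, herr⟩ := exists_weights_of_isLowerSet μ B hB hmono Finset.univ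
    (by simp [isLowerSet_univ]) Bool d hd (ε / ((n + 1) * (n + 1))) (by positivity)
  have hindw : IsIndependent μ B w p := fun J c S hS =>
    hind J (w J c) (p J c) ((hw J).measurable c) ((hw J).abs_le_one c)
      ((hw J).setIntegral_eq c) S hS
  have hp0 : ∀ J c, 0 ≤ p J c := fun J c => (hw J).const_nonneg c
  have hwm : ∀ J c, Measurable[m0] (w J c) := fun J c => ((hw J).measurable c).mono (hB J) le_rfl
  let W' : Finset (Finset W) → (Finset W → C) → X → ℝ := fun Δ c x => ∏ J ∈ Δ, w J (c J) x
  have hW'm : ∀ Δ c, Measurable[m0] (W' Δ c) := fun Δ c =>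
    Finset.measurable_prod _ fun J _ => hwm J _
  have hW'1 : ∀ Δ c x, |W' Δ c x| ≤ 1 := fun Δ c x =>
    prod_abs_le_one fun J => (hw J).abs_le_one _ x
  have hW'0 : ∀ Δ c x, 0 ≤ W' Δ c x := fun Δ c x =>
    Finset.prod_nonneg fun J _ => (hw J).nonneg _ x
  have hW'i : ∀ Δ c, Integrable (W' Δ c) μ := fun Δ c =>
    integrable_of_bounded (hW'm Δ c) (hW'1 Δ c)
  let e : Finset W → X → ℝ := fun I => (E I)ᶜ.indicator 1
  have he0 : ∀ I x, 0 ≤ e I x := fun I x => indicator_nonneg (fun _ _ => zero_le_one) x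
  have he1 : ∀ I x, |e I x| ≤ 1 := fun I x => by
    by_cases h : x ∈ E I <;> simp [e, h]
  have hem : ∀ I ∈ F, Measurable[B I] (e I) := fun I hI =>
    measurable_const.indicator (hE I hI).compl
  let a : Finset W → (Finset W → C) → ℝ := fun I c => ∫ x, e I x * W' I.powerset c x ∂μ
  have ha0 : ∀ I c, 0 ≤ a I c := fun I c =>
    integral_nonneg fun x => mul_nonneg (he0 I x) (hW'0 _ c x)
  let P : Finset (Finset W) → (Finset W → C) → ℝ := fun Δ c => ∏ J ∈ Δ, p J (c J)
  have hP0 : ∀ Δ c, 0 ≤ P Δ c := fun Δ c => Finset.prod_nonneg fun J _ => hp0 J _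
  have hPW : ∀ Δ c, ∫ x, W' Δ c x ∂μ = P Δ c := by
    intro Δ c
    have := integral_mul_prod_weights μ B hB hw hindw c (g := fun _ => 1) (K := 1)
      (fun x => by simp) Δ (fun J _ => measurable_const)
    simpa using this
  have haΔ : ∀ I ∈ F, ∀ c Δ, I.powerset ⊆ Δ →
      ∫ x, e I x * W' Δ c x ∂μ = P (Δ \ I.powerset) c * a I c := by
    intro I hI c Δ hΔ
    have := integral_mul_prod_weights μ B hB hw hindw c (g := fun x => e I x * W' I.powerset c x)
      (K := 1) (fun x => by
        rw [abs_mul]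
        exact mul_le_one₀ (he1 I x) (abs_nonneg _) (hW'1 _ c x)) (Δ \ I.powerset) (by
        intro J hJ
        have hJI : ¬ J ⊆ I := by simpa using (Finset.mem_sdiff.1 hJ).2
        have h1 : B I ≤ ⨆ J', ⨆ (_ : ¬ J ⊆ J'), B J' :=
          le_iSup₂_of_le (f := fun J' (_ : ¬ J ⊆ J') => B J') I hJI le_rfl
        refine Measurable.mono ((hem I hI).mul (Finset.measurable_prod _ fun J' hJ' => ?_)) h1
          le_rfl
        exact ((hw J').measurable _).mono (hmono (Finset.mem_powerset.1 hJ')) le_rfl)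
    refine Eq.trans ?_ this
    refine integral_congr_ae (Filter.Eventually.of_forall fun x => ?_)
    simp only [W']
    rw [← Finset.prod_sdiff hΔ]
    ring
  have hPsplit : ∀ (I : Finset W) (c : Finset W → C) (Δ : Finset (Finset W)), I.powerset ⊆ Δ →
      P Δ c = P (Δ \ I.powerset) c * P I.powerset c :=
    fun I c Δ hΔ => (Finset.prod_sdiff hΔ).symm
  let Good : Finset W → Set (Finset W → C) := fun I => {c | n * a I c < P I.powerset c}
  let err : Finset W → (Finset W → C) → ℝ := fun I c =>
    ∫ x, (if T I c = d I x then 0 else W' Finset.univ c x) ∂μ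
  have hiteint : ∀ I c, Integrable
      (fun x => if T I c = d I x then 0 else W' Finset.univ c x) μ := fun I c =>
    integrable_ite_fiber (e := fun _ => T I c)
      (fun b => @measurable_const _ _ ⊤ m0 (T I c) _ trivial)
      (fun b => hB I _ (hd I b)) (hW'm _ c) (hW'1 _ c)
  have herr' : ∀ I, ∑ c, err I c ≤ ε / ((n + 1) * (n + 1)) := by
    intro I
    rw [← integral_finsetSum _ fun c _ => hiteint I c]
    exact herr I (Finset.mem_univ I)
  have herr0 : ∀ I c, 0 ≤ err I c := fun I c => integral_nonneg fun x => by
    dsimp only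
    split_ifs
    · exact le_rfl
    · exact hW'0 _ c x
  have hEi : ∀ I ∈ F, ∀ c, Integrable (fun x => (E I).indicator 1 x * W' Finset.univ c x) μ := by
    intro I hI c
    refine integrable_of_bounded (K := 1)
      ((measurable_const.indicator (hB I _ (hE I hI))).mul (hW'm _ c)) fun x => ?_
    by_cases h : x ∈ E I
    · simpa [h] using hW'1 _ c x
    · simp [h]
  have hei : ∀ I ∈ F, ∀ Δ c, Integrable (fun x => e I x * W' Δ c x) μ := by
    intro I hI Δ c
    refine integrable_of_bounded (K := 1)
      (((hem I hI).mono (hB I) le_rfl).mul (hW'm _ c)) fun x => ?_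
    rw [abs_mul]
    exact mul_le_one₀ (he1 I x) (abs_nonneg _) (hW'1 _ c x)
  have hbad : ∀ I ∈ F, ∀ c, c ∉ Good I →
      ∫ x, (E I).indicator 1 x * W' Finset.univ c x ∂μ ≤ (n + 1) * err I c := by
    intro I hI c hc
    have hc' : P I.powerset c ≤ n * a I c := not_lt.1 hc
    cases hT : T I c
    · have h1 : ∫ x, (E I).indicator 1 x * W' Finset.univ c x ∂μ ≤ err I c := by
        refine integral_mono (hEi I hI c) (hiteint I c) fun x => ?_
        by_cases h : x ∈ E I
        · simp [h, hT, d, hI]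
        · simp only [h, not_false_eq_true, indicator_of_notMem, zero_mul]
          split_ifs
          · exact le_rfl
          · exact hW'0 _ c x
      nlinarith [herr0 I c]
    · have h2 : err I c = ∫ x, e I x * W' Finset.univ c x ∂μ := by
        refine integral_congr_ae (Filter.Eventually.of_forall fun x => ?_)
        by_cases h : x ∈ E I
        · simp [h, hT, d, hI, e]
        · simp [h, hT, d, e]
      have h3 : ∫ x, (E I).indicator 1 x * W' Finset.univ c x ∂μ ≤ P Finset.univ c := by
        rw [← hPW]
        refine integral_mono (hEi I hI c) (hW'i _ c) fun x => ?_
        by_cases h : x ∈ E I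
        · simp [h]
        · simpa [h] using hW'0 _ c x
      rw [haΔ I hI c _ (Finset.subset_univ _)] at h2
      rw [hPsplit I c _ (Finset.subset_univ _)] at h3
      have h4 := mul_le_mul_of_nonneg_left hc' (hP0 (Finset.univ \ I.powerset) c)
      have h5 := herr0 I c
      rw [h2] at h5 ⊢
      nlinarith
  let h : (Finset W → C) → X → ℝ := fun c x =>
    ∑ I ∈ F, if c ∈ Good I then 0 else (E I).indicator 1 x
  have hh : ∀ c, Measurable[m0] (h c) := by
    intro c
    refine Finset.measurable_sum _ fun I hI => ?_
    split_ifs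
    · exact measurable_const
    · exact measurable_const.indicator (hB I _ (hE I hI))
  have hhterm : ∀ c I x, 0 ≤ (if c ∈ Good I then (0 : ℝ) else (E I).indicator 1 x) ∧
      (if c ∈ Good I then (0 : ℝ) else (E I).indicator 1 x) ≤ 1 := by
    intro c I x
    by_cases h1 : c ∈ Good I <;> by_cases h2 : x ∈ E I <;> simp [h1, h2]
  have hhL : ∀ c x, |h c x| ≤ n := by
    intro c x
    rw [abs_of_nonneg (Finset.sum_nonneg fun I _ => (hhterm c I x).1)]
    calc h c x ≤ ∑ _I ∈ F, (1 : ℝ) := Finset.sum_le_sum fun I _ => (hhterm c I x).2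
      _ = n := by simp [n]
  obtain ⟨γ, hγ, hγle⟩ := exists_selection μ B hB (fun J c => (hw J).measurable c)
    (fun J c x => (hw J).nonneg c x) (fun J x => (hw J).sum_eq x) hh hhL
  have htotal : ∫ x, (∑ c, h c x * ∏ J, w J (c J) x) ∂μ ≤ ε := by
    have e1 : ∀ x, ∑ c, h c x * ∏ J, w J (c J) x = ∑ I ∈ F, ∑ c, if c ∈ Good I then 0 else
        (E I).indicator 1 x * W' Finset.univ c x := by
      intro x
      rw [Finset.sum_comm]
      refine Finset.sum_congr rfl fun c _ => ?_
      rw [Finset.sum_mul]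
      refine Finset.sum_congr rfl fun I _ => ?_
      split_ifs
      · simp
      · rfl
    have hi : ∀ I ∈ F, ∀ c, Integrable (fun x => if c ∈ Good I then 0 else
        (E I).indicator 1 x * W' Finset.univ c x) μ := by
      intro I hI c
      by_cases hc : c ∈ Good I
      · simp [hc]
      · simpa only [hc, if_false] using hEi I hI c
    simp only [e1]
    rw [integral_finsetSum _ fun I hI => integrable_finsetSum _ fun c _ => hi I hI c]
    calc _ = ∑ I ∈ F, ∑ c, ∫ x, (if c ∈ Good I then 0 else
          (E I).indicator 1 x * W' Finset.univ c x) ∂μ :=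
          Finset.sum_congr rfl fun I hI => integral_finsetSum _ fun c _ => hi I hI c
      _ ≤ ∑ I ∈ F, ∑ c, (n + 1) * err I c := by
          refine Finset.sum_le_sum fun I hI => Finset.sum_le_sum fun c _ => ?_
          by_cases hc : c ∈ Good I
          · simp only [hc, if_true, integral_zero]
            exact mul_nonneg (by positivity) (herr0 I c)
          · simpa only [hc, if_false] using hbad I hI c hc
      _ ≤ ∑ I ∈ F, (n + 1) * (ε / ((n + 1) * (n + 1))) := by
          refine Finset.sum_le_sum fun I _ => ?_
          rw [← Finset.mul_sum]
          exact mul_le_mul_of_nonneg_left (herr' I) (by positivity)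
      _ = n / (n + 1) * ε := by
          rw [Finset.sum_const, nsmul_eq_mul]
          field_simp
          rfl
      _ ≤ 1 * ε := by
          gcongr
          exact div_le_one_of_le₀ (by linarith) (by positivity)
      _ = ε := one_mul ε
  refine ⟨C, inferInstance, inferInstance, γ, Good, hγ, ?_, ?_, ?_⟩
  · intro I c c' hcc hc
    have h1 : ∀ J ∈ I.powerset, c J = c' J := fun J hJ => hcc J (Finset.mem_powerset.1 hJ)
    have h2 : P I.powerset c' = P I.powerset c :=
      Finset.prod_congr rfl fun J hJ => by rw [h1 J hJ]
    have h3 : a I c' = a I c := by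
      simp only [a, W']
      refine integral_congr_ae (Filter.Eventually.of_forall fun x => ?_)
      dsimp only
      congr 1
      exact Finset.prod_congr rfl fun J hJ => by rw [h1 J hJ]
    show n * a I c' < P I.powerset c'
    rw [h2, h3]
    exact hc
  · intro c
    by_contra hcon
    push Not at hcon
    have hFne : F.Nonempty := by
      rw [Finset.nonempty_iff_ne_empty]
      rintro rfl
      simp at hnull
    have hpos : ∀ I ∈ F, 0 < P I.powerset c := fun I hI =>
      lt_of_le_of_lt (mul_nonneg hn0 (ha0 I c)) (hcon I hI)
    let Δ := F.biUnion Finset.powerset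
    have hsubΔ : ∀ I ∈ F, I.powerset ⊆ Δ := fun I hI =>
      Finset.subset_biUnion_of_mem Finset.powerset hI
    have hpΔ : ∀ J ∈ Δ, 0 < p J (c J) := by
      intro J hJ
      obtain ⟨I, hI, hJI⟩ := Finset.mem_biUnion.1 hJ
      refine lt_of_le_of_ne (hp0 J _) fun h0 => ?_
      exact (hpos I hI).ne' (Finset.prod_eq_zero hJI h0.symm)
    have hlt : ∑ I ∈ F, n * ∫ x, e I x * W' Δ c x ∂μ < ∑ I ∈ F, P Δ c := by
      refine Finset.sum_lt_sum_of_nonempty hFne fun I hI => ?_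
      rw [haΔ I hI c Δ (hsubΔ I hI), hPsplit I c Δ (hsubΔ I hI)]
      have h1 : 0 < P (Δ \ I.powerset) c :=
        Finset.prod_pos fun J hJ => hpΔ J (Finset.mem_sdiff.1 hJ).1
      have h2 : n * a I c < P I.powerset c := hcon I hI
      nlinarith [mul_lt_mul_of_pos_left h2 h1]
    have hn1 : 0 < n := by
      simp only [n]
      exact_mod_cast hFne.card_pos
    rw [← Finset.mul_sum, Finset.sum_const, nsmul_eq_mul] at hlt
    have hlt' : ∑ I ∈ F, ∫ x, e I x * W' Δ c x ∂μ < P Δ c := lt_of_mul_lt_mul_left hlt hn0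
    rw [← hPW, ← integral_finsetSum _ fun I hI => hei I hI Δ c] at hlt'
    refine absurd hlt' (not_lt.2 ?_)
    refine integral_mono_ae (hW'i Δ c) (integrable_finsetSum _ fun I hI => hei I hI Δ c) ?_
    have hae : ∀ᵐ x ∂μ, x ∉ ⋂ I ∈ F, E I := measure_eq_zero_iff_ae_notMem.1 hnull
    filter_upwards [hae] with x hx
    simp only [mem_iInter, not_forall] at hx
    obtain ⟨I, hI, hxI⟩ := hx
    have h1 := Finset.single_le_sum (f := fun I => e I x * W' Δ c x)
      (fun I _ => mul_nonneg (he0 I x) (hW'0 Δ c x)) hI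
    simpa [e, hxI] using h1
  · intro I hI
    have hγh : Measurable[m0] fun x => h (fun J => γ J x) x :=
      measurable_apply_of_fibers (d := fun x J => γ J x) (f := fun c x => h c x)
        (measurableSet_fiber_pi fun J c => hB J _ (hγ J c)) hh
    have hS : MeasurableSet[m0] (E I ∩ {x | (fun J => γ J x) ∉ Good I}) :=
      (hB I _ (hE I hI)).inter (measurableSet_preimage_of_fibers (d := fun x J => γ J x)
        (measurableSet_fiber_pi fun J c => hB J _ (hγ J c)) (Good I)ᶜ)
    calc μ.real (E I ∩ {x | (fun J => γ J x) ∉ Good I})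
        = ∫ x, (E I ∩ {x | (fun J => γ J x) ∉ Good I}).indicator (fun _ => (1 : ℝ)) x ∂μ := by
          rw [integral_indicator_const _ hS]
          simp
      _ ≤ ∫ x, h (fun J => γ J x) x ∂μ := by
          refine integral_mono ((integrable_const 1).indicator hS)
            (integrable_of_bounded hγh fun x => hhL _ x) fun x => ?_
          have h1 := Finset.single_le_sum
            (f := fun I => if (fun J => γ J x) ∈ Good I then (0 : ℝ) else (E I).indicator 1 x)
            (fun I _ => (hhterm _ I x).1) hI
          refine le_trans ?_ h1
          by_cases h1 : (fun J => γ J x) ∈ Good I <;> by_cases h2 : x ∈ E I <;>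
            simp [h1, h2]
      _ ≤ ε := hγle.trans htotal

theorem exists_finite_valued_approx {X : Type*} {m0 : MeasurableSpace X} (μ : Measure X)
    [IsProbabilityMeasure μ] {𝒜 : Set (Set X)} (h𝒜 : IsSetAlgebra 𝒜)
    (hle : MeasurableSpace.generateFrom 𝒜 ≤ m0) {w : X → ℝ}
    (hw : Measurable[MeasurableSpace.generateFrom 𝒜] w) (hw1 : ∀ x, |w x| ≤ 1) {η : ℝ}
    (hη : 0 < η) :
    ∃ (C : Type) (_ : Fintype C) (γ : X → C) (v : C → ℝ), (∀ c, γ ⁻¹' {c} ∈ 𝒜) ∧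
      (∀ c, |v c| ≤ 1) ∧ ∫ x, |w x - v (γ x)| ∂μ ≤ η := by
  obtain ⟨N, hN⟩ := exists_nat_gt (2 / η)
  have hN0 : (0 : ℝ) < N := lt_trans (by positivity) hN
  have hNη : 1 / (N : ℝ) ≤ η / 2 := by
    rw [div_lt_iff₀ hη] at hN
    rw [div_le_iff₀ hN0]
    linarith
  let f : X → ℕ := fun x => ⌊(w x + 1) * N⌋₊
  have hf0 : ∀ x, 0 ≤ (w x + 1) * N := fun x =>
    mul_nonneg (by linarith [(abs_le.1 (hw1 x)).1]) hN0.le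
  have hf : ∀ x, f x < 2 * N + 1 := by
    intro x
    rw [Nat.lt_succ_iff]
    refine Nat.floor_le_of_le ?_
    push_cast
    nlinarith [(abs_le.1 (hw1 x)).2]
  let γ : X → Fin (2 * N + 1) := fun x => ⟨f x, hf x⟩
  let v : Fin (2 * N + 1) → ℝ := fun c => (c : ℕ) / N - 1
  have hv : ∀ c, |v c| ≤ 1 := by
    intro c
    have h1 : ((c : ℕ) : ℝ) ≤ 2 * N := by exact_mod_cast Nat.lt_succ_iff.1 c.2
    have h2 : ((c : ℕ) : ℝ) / N ≤ 2 := by rwa [div_le_iff₀ hN0]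
    have h3 : 0 ≤ ((c : ℕ) : ℝ) / N := by positivity
    simp only [v, abs_le]
    constructor <;> linarith
  have hwv : ∀ x, |w x - v (γ x)| ≤ η / 2 := by
    intro x
    refine le_trans ?_ hNη
    have h1 : ((f x : ℕ) : ℝ) ≤ (w x + 1) * N := Nat.floor_le (hf0 x)
    have h2 : (w x + 1) * N < (f x : ℕ) + 1 := Nat.lt_floor_add_one _
    have h3 : w x - v (γ x) = ((w x + 1) * N - f x) / N := by
      simp only [v, γ]
      field_simp
      ring
    rw [h3, abs_div, abs_of_pos hN0]
    gcongr
    rw [abs_le]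
    constructor <;> linarith
  have hγ : ∀ c, MeasurableSet[MeasurableSpace.generateFrom 𝒜] (γ ⁻¹' {c}) := by
    intro c
    have h1 : Measurable[MeasurableSpace.generateFrom 𝒜] f :=
      Nat.measurable_floor.comp ((hw.add_const 1).mul_const _)
    have h2 : γ ⁻¹' {c} = f ⁻¹' {(c : ℕ)} := by
      ext x
      simp [γ, Fin.ext_iff]
    rw [h2]
    exact h1 (measurableSet_singleton _)
  obtain ⟨γ', hγ', hγγ'⟩ := exists_fiber_mem_algebra_approx μ h𝒜 hle hγ
    (ε := η / 4) (by positivity)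
  refine ⟨_, inferInstance, γ', v, hγ', hv, ?_⟩
  have hγ'm : Measurable[m0] γ' := measurable_to_countable' fun c =>
    hle _ (MeasurableSpace.measurableSet_generateFrom (hγ' c))
  have hγm : Measurable[m0] γ := measurable_to_countable' fun c => hle _ (hγ c)
  have hwm : Measurable[m0] w := hw.mono hle le_rfl
  have hS : MeasurableSet[m0] {x | γ x ≠ γ' x} := (measurableSet_eq_fun hγm hγ'm).compl
  have hvm : Measurable[m0] fun x => v (γ' x) := (measurable_of_finite v).comp hγ'm
  calc ∫ x, |w x - v (γ' x)| ∂μ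
      ≤ ∫ x, (η / 2 + {x | γ x ≠ γ' x}.indicator (fun _ => (2 : ℝ)) x) ∂μ := by
        refine integral_mono (integrable_of_bounded (K := 2) (hwm.sub hvm).abs fun x => ?_)
          ((integrable_const _).add ((integrable_const _).indicator hS)) fun x => ?_
        · rw [abs_abs]
          exact (abs_sub _ _).trans (by linarith [hw1 x, hv (γ' x)])
        · by_cases h : γ x = γ' x
          · have := hwv x
            rw [h] at this
            simpa [h] using this
          · simp only [mem_ofPred_eq, ne_eq, h, not_false_eq_true, indicator_of_mem]
            exact (abs_sub _ _).trans (by linarith [hw1 x, hv (γ' x)])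
    _ = η / 2 + μ.real {x | γ x ≠ γ' x} * 2 := by
        rw [integral_add (integrable_const _) ((integrable_const _).indicator hS),
          integral_indicator_const _ hS]
        simp
    _ ≤ η := by linarith

theorem setIntegral_le_of_averaging {X : Type*} {m0 : MeasurableSpace X} (μ : Measure X)
    [IsProbabilityMeasure μ] {𝒜 : Set (Set X)} (h𝒜 : IsSetAlgebra 𝒜)
    (hle : MeasurableSpace.generateFrom 𝒜 ≤ m0) {mb : MeasurableSpace X}
    {S : Set X}
    (hS : ∀ (C : Type) [Fintype C] (γ : X → C) (v : C → ℝ), (∀ c, γ ⁻¹' {c} ∈ 𝒜) →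
      ∃ S', MeasurableSet[mb] S' ∧ ∫ x in S, v (γ x) ∂μ ≤ ∫ x in S', v (γ x) ∂μ)
    {w : X → ℝ} {p : ℝ} (hw : Measurable[MeasurableSpace.generateFrom 𝒜] w)
    (hw1 : ∀ x, |w x| ≤ 1)
    (hwp : ∀ S, MeasurableSet[mb] S → ∫ x in S, w x ∂μ = p * μ.real S) :
    ∫ x in S, w x ∂μ ≤ p * μ.real S := by
  refine le_of_forall_pos_le_add fun η hη => ?_
  obtain ⟨C, _, γ, v, hγ, hv, hwv⟩ := exists_finite_valued_approx μ h𝒜 hle hw hw1 (half_pos hη)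
  obtain ⟨S', hS', hSS'⟩ := hS C γ (fun c => v c - p) hγ
  have hγm : @Measurable _ _ m0 ⊤ γ := @measurable_to_countable' C X ⊤ inferInstance m0 γ fun c =>
    hle _ (MeasurableSpace.measurableSet_generateFrom (hγ c))
  have hwm : Measurable[m0] w := hw.mono hle le_rfl
  have hvm : Measurable[m0] fun x => v (γ x) := fun s _ =>
    hγm (t := v ⁻¹' s) trivial
  have hwi : Integrable w μ := integrable_of_bounded hwm hw1
  have hvi : Integrable (fun x => v (γ x)) μ := integrable_of_bounded hvm fun x => hv _
  have hdi : Integrable (fun x => |w x - v (γ x)|) μ := (hwi.sub hvi).abs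
  have hclose : ∀ T, |(∫ x in T, w x ∂μ) - ∫ x in T, v (γ x) ∂μ| ≤ η / 2 := by
    intro T
    rw [← integral_sub hwi.integrableOn hvi.integrableOn]
    refine (abs_integral_le_integral_abs).trans (le_trans ?_ hwv)
    exact setIntegral_le_integral hdi (Filter.Eventually.of_forall fun x => abs_nonneg _)
  have hp : ∀ T, ∫ x in T, (v (γ x) - p) ∂μ = (∫ x in T, v (γ x) ∂μ) - p * μ.real T := by
    intro T
    rw [integral_sub hvi.integrableOn (integrable_const p).integrableOn]
    simp [mul_comm]
  rw [hp, hp, ← hwp S' hS'] at hSS'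
  have h1 := abs_le.1 (hclose S)
  have h2 := abs_le.1 (hclose S')
  linarith

theorem setIntegral_eq_of_averaging {X : Type*} {m0 : MeasurableSpace X} (μ : Measure X)
    [IsProbabilityMeasure μ] {𝒜 : Set (Set X)} (h𝒜 : IsSetAlgebra 𝒜)
    (hle : MeasurableSpace.generateFrom 𝒜 ≤ m0) {mb : MeasurableSpace X}
    {P : Set (Set X)} (hP : IsPiSystem P) (hPm : MeasurableSpace.generateFrom P ≤ m0)
    (hav : ∀ S ∈ P, ∀ (C : Type) [Fintype C] (γ : X → C) (v : C → ℝ), (∀ c, γ ⁻¹' {c} ∈ 𝒜) →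
      ∃ S', MeasurableSet[mb] S' ∧ ∫ x in S, v (γ x) ∂μ ≤ ∫ x in S', v (γ x) ∂μ)
    {w : X → ℝ} {p : ℝ} (hw : Measurable[MeasurableSpace.generateFrom 𝒜] w)
    (hw1 : ∀ x, |w x| ≤ 1)
    (hwp : ∀ S, MeasurableSet[mb] S → ∫ x in S, w x ∂μ = p * μ.real S)
    {S : Set X} (hS : MeasurableSet[MeasurableSpace.generateFrom P] S) :
    ∫ x in S, w x ∂μ = p * μ.real S := by
  have hwi : Integrable w μ := integrable_of_bounded (hw.mono hle le_rfl) hw1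
  induction S, hS using MeasurableSpace.induction_on_inter (m := MeasurableSpace.generateFrom P)
    rfl hP with
  | empty => simp
  | basic t ht =>
    refine le_antisymm (setIntegral_le_of_averaging μ h𝒜 hle (hav t ht) hw hw1 hwp) ?_
    have h := setIntegral_le_of_averaging μ h𝒜 hle (hav t ht) (w := fun x => - w x)
      (p := -p) hw.neg (fun x => by rw [abs_neg]; exact hw1 x) (fun S hS => by
        rw [integral_neg, hwp S hS, neg_mul])
    rw [integral_neg] at h
    linarith
  | compl t ht ih =>
    have htm := hPm _ ht
    have h1 := integral_add_compl htm hwi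
    have h2 := hwp univ MeasurableSet.univ
    rw [setIntegral_univ, probReal_univ] at h2
    rw [probReal_compl_eq_one_sub htm]
    linarith
  | iUnion f hd hf ih =>
    have hfm := fun i => hPm _ (hf i)
    have h1 := hasSum_integral_iUnion hfm hd hwi.integrableOn
    have h2 := hasSum_integral_iUnion hfm hd (integrable_const p).integrableOn (μ := μ)
    have h3 : (fun i => ∫ _ in f i, p ∂μ) = fun i => ∫ x in f i, w x ∂μ := by
      funext i
      rw [ih i]
      simp [mul_comm]
    rw [h3] at h2
    rw [h1.unique h2]
    simp [mul_comm]

/-- The proportion of a finite type occupied by a set. -/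
noncomputable def density {α : Type*} [Fintype α] (A : Set α) : ℝ := A.ncard / Fintype.card α

theorem density_nonneg {α : Type*} [Fintype α] (A : Set α) : 0 ≤ density A := by
  unfold density
  positivity

theorem density_empty {α : Type*} [Fintype α] : density (∅ : Set α) = 0 := by
  simp [density]

theorem density_univ {α : Type*} [Fintype α] [Nonempty α] : density (univ : Set α) = 1 := by
  have : (Fintype.card α : ℝ) ≠ 0 := by exact_mod_cast Fintype.card_ne_zero
  simp [density, ncard_univ, this]

theorem density_union {α : Type*} [Fintype α] {A B : Set α} (h : Disjoint A B) :
    density (A ∪ B) = density A + density B := by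
  simp only [density]
  rw [ncard_union_eq h (toFinite _) (toFinite _), Nat.cast_add, add_div]

/-- The subset of the product cut out, along a fixed nonprincipal ultrafilter, by a sequence of
sets. -/
def internal {Ω : ℕ → Type*} (A : ∀ n, Set (Ω n)) : Set (∀ n, Ω n) :=
  {x | ∀ᶠ n in (Filter.hyperfilter ℕ : Filter ℕ), x n ∈ A n}

section Internal

variable {Ω : ℕ → Type*} {A B : ∀ n, Set (Ω n)}

theorem mem_internal {x : ∀ n, Ω n} :
    x ∈ internal A ↔ ∀ᶠ n in (Filter.hyperfilter ℕ : Filter ℕ), x n ∈ A n := Iff.rfl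

theorem internal_compl : (internal A)ᶜ = internal fun n => (A n)ᶜ := by
  ext x
  simp only [mem_compl_iff, mem_internal]
  exact Ultrafilter.eventually_not.symm

theorem internal_union : internal A ∪ internal B = internal fun n => A n ∪ B n := by
  ext x
  simp only [mem_union, mem_internal]
  exact Ultrafilter.eventually_or.symm

theorem internal_inter : internal A ∩ internal B = internal fun n => A n ∩ B n := by
  ext x
  simp only [mem_inter_iff, mem_internal]
  exact Filter.eventually_and.symm

theorem internal_empty : internal (fun n => (∅ : Set (Ω n))) = ∅ := by
  ext x
  simp [mem_internal, (Filter.hyperfilter ℕ).neBot.ne]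

theorem internal_univ : internal (fun n => (univ : Set (Ω n))) = univ := by
  ext x
  simp [mem_internal]

theorem internal_subset_iff [∀ n, Nonempty (Ω n)] : internal A ⊆ internal B ↔
    ∀ᶠ n in (Filter.hyperfilter ℕ : Filter ℕ), A n ⊆ B n := by
  constructor
  · intro h
    by_contra hcon
    rw [← Ultrafilter.eventually_not] at hcon
    have : ∀ n, ∃ x, ¬ A n ⊆ B n → x ∈ A n ∧ x ∉ B n := by
      intro n
      by_cases hn : A n ⊆ B n
      · exact ⟨Classical.arbitrary _, fun h => absurd hn h⟩
      · obtain ⟨x, hx⟩ := not_subset.1 hn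
        exact ⟨x, fun _ => hx⟩
    choose x hx using this
    have h1 : x ∈ internal A := hcon.mono fun n hn => (hx n hn).1
    have h2 : x ∈ internal B := h h1
    have h3 : ∀ᶠ n in (Filter.hyperfilter ℕ : Filter ℕ), False := by
      filter_upwards [hcon, mem_internal.1 h2] with n hn hn'
      exact (hx n hn).2 hn'
    exact h3.exists.choose_spec
  · intro h x hx
    filter_upwards [h, mem_internal.1 hx] with n hn hn'
    exact hn hn'

theorem internal_eq_iff [∀ n, Nonempty (Ω n)] : internal A = internal B ↔
    ∀ᶠ n in (Filter.hyperfilter ℕ : Filter ℕ), A n = B n := by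
  rw [subset_antisymm_iff, internal_subset_iff, internal_subset_iff, ← Filter.eventually_and]
  simp only [subset_antisymm_iff]

theorem internal_eq_empty_iff [∀ n, Nonempty (Ω n)] : internal A = ∅ ↔
    ∀ᶠ n in (Filter.hyperfilter ℕ : Filter ℕ), A n = ∅ := by
  rw [← internal_empty, internal_eq_iff]

theorem isSetAlgebra_range_internal : IsSetAlgebra (range (internal (Ω := Ω))) where
  empty_mem := ⟨_, internal_empty⟩
  compl_mem := by
    rintro _ ⟨A, rfl⟩
    exact ⟨_, internal_compl.symm⟩
  union_mem := by
    rintro _ _ ⟨A, rfl⟩ ⟨B, rfl⟩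
    exact ⟨_, internal_union.symm⟩

/-- Countable saturation: a decreasing sequence of nonempty internal sets has a common point. -/
theorem nonempty_iInter_internal [∀ n, Nonempty (Ω n)] (A : ℕ → ∀ n, Set (Ω n))
    (hanti : Antitone fun i => internal (A i)) (hne : ∀ i, (internal (A i)).Nonempty) :
    (⋂ i, internal (A i)).Nonempty := by
  classical
  let D : ℕ → ∀ n, Set (Ω n) := fun i n => ⋂ j ≤ i, A j n
  have hD : ∀ i, ∀ᶠ n in (Filter.hyperfilter ℕ : Filter ℕ), (D i n).Nonempty := by
    intro i
    obtain ⟨x, hx⟩ := hne i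
    have h1 : ∀ j ∈ Finset.range (i + 1), ∀ᶠ n in (Filter.hyperfilter ℕ : Filter ℕ),
        x n ∈ A j n := fun j hj => hanti (Nat.lt_succ_iff.1 (Finset.mem_range.1 hj)) hx
    rw [← Filter.eventually_all_finset] at h1
    filter_upwards [h1] with n hn
    exact ⟨x n, mem_iInter₂.2 fun j hj => hn j (Finset.mem_range.2 (Nat.lt_succ_iff.2 hj))⟩
  let k : ℕ → ℕ := fun n => Nat.findGreatest (fun i => (D i n).Nonempty) n
  have hx : ∀ n, ∃ x, (D (k n) n).Nonempty → x ∈ D (k n) n := by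
    intro n
    by_cases h : (D (k n) n).Nonempty
    · exact ⟨h.some, fun _ => h.some_mem⟩
    · exact ⟨Classical.arbitrary _, fun h' => absurd h' h⟩
  choose x hx using hx
  refine ⟨x, mem_iInter.2 fun i => ?_⟩
  have hi : ∀ᶠ n in (Filter.hyperfilter ℕ : Filter ℕ), i ≤ n :=
    Nat.hyperfilter_le_atTop (Filter.eventually_ge_atTop i)
  filter_upwards [hi, hD i] with n hn hne'
  have h1 : i ≤ k n := Nat.le_findGreatest hn hne'
  have h2 : (D (k n) n).Nonempty :=
    Nat.findGreatest_spec (P := fun i => (D i n).Nonempty) hn hne'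
  exact mem_iInter₂.1 (hx n h2) i h1

variable [∀ n, Fintype (Ω n)]

open scoped Classical in
/-- The limit density of an internal set. -/
noncomputable def limitDensity (s : Set (∀ n, Ω n)) : ENNReal :=
  if h : ∃ A, internal A = s then
    ((Filter.hyperfilter ℕ).map fun n => ENNReal.ofReal (density (h.choose n))).lim
  else 0

theorem tendsto_limitDensity [∀ n, Nonempty (Ω n)] (A : ∀ n, Set (Ω n)) :
    Filter.Tendsto (fun n => ENNReal.ofReal (density (A n))) (Filter.hyperfilter ℕ)
      (nhds (limitDensity (internal A))) := by
  have h : ∃ B, internal B = internal A := ⟨A, rfl⟩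
  have h1 : Filter.Tendsto (fun n => ENNReal.ofReal (density (h.choose n)))
      (Filter.hyperfilter ℕ) (nhds (limitDensity (internal A))) := by
    rw [limitDensity, dif_pos h]
    exact Ultrafilter.le_nhds_lim _
  refine h1.congr' ?_
  filter_upwards [internal_eq_iff.1 h.choose_spec] with n hn
  rw [hn]

/-- The finitely additive limit density on the algebra of internal sets. -/
noncomputable def limitContent (Ω : ℕ → Type*) [∀ n, Fintype (Ω n)] [∀ n, Nonempty (Ω n)] :
    AddContent ENNReal (range (internal (Ω := Ω))) :=
  isSetAlgebra_range_internal.isSetRing.addContent_of_union limitDensity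
    (by
      rw [← internal_empty]
      refine tendsto_nhds_unique (tendsto_limitDensity _) ?_
      simp only [density_empty, ENNReal.ofReal_zero]
      exact tendsto_const_nhds)
    (by
      rintro _ _ ⟨A, rfl⟩ ⟨B, rfl⟩ hd
      rw [disjoint_iff_inter_eq_empty, internal_inter, internal_eq_empty_iff] at hd
      rw [internal_union]
      refine tendsto_nhds_unique (tendsto_limitDensity _) ?_
      refine ((tendsto_limitDensity A).add (tendsto_limitDensity B)).congr' ?_
      filter_upwards [hd] with n hn
      rw [density_union (disjoint_iff_inter_eq_empty.2 hn),
        ENNReal.ofReal_add (density_nonneg _) (density_nonneg _)])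

theorem limitContent_apply [∀ n, Nonempty (Ω n)] (s : Set (∀ n, Ω n)) :
    limitContent Ω s = limitDensity s := rfl

theorem limitDensity_univ [∀ n, Nonempty (Ω n)] :
    limitDensity (univ : Set (∀ n, Ω n)) = 1 := by
  rw [← internal_univ]
  refine tendsto_nhds_unique (tendsto_limitDensity _) ?_
  simp only [density_univ, ENNReal.ofReal_one]
  exact tendsto_const_nhds

theorem isSigmaSubadditive_limitContent [∀ n, Nonempty (Ω n)] :
    (limitContent Ω).IsSigmaSubadditive := by
  have hR := (isSetAlgebra_range_internal (Ω := Ω)).isSetRing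
  refine isSigmaSubadditive_of_addContent_iUnion_eq_tsum hR ?_
  refine addContent_iUnion_eq_sum_of_tendsto_zero hR _ ?_ ?_
  · intro s hs
    refine ne_top_of_le_ne_top ENNReal.one_ne_top (b := 1) ?_
    rw [← limitDensity_univ (Ω := Ω), ← limitContent_apply]
    exact addContent_mono hR.isSetSemiring hs ⟨_, internal_univ⟩ (subset_univ s)
  · intro s hs hanti hinter
    choose A hA using hs
    obtain ⟨i, hi⟩ : ∃ i, s i = ∅ := by
      by_contra hcon
      push Not at hcon
      have := nonempty_iInter_internal A (by simpa only [hA] using hanti)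
        (by simpa only [hA] using hcon)
      simp only [hA, hinter] at this
      exact not_nonempty_empty this
    refine tendsto_const_nhds.congr' ?_
    filter_upwards [Filter.eventually_ge_atTop i] with j hj
    have h1 : s j = ∅ := subset_empty_iff.1 (hi ▸ hanti hj)
    rw [h1, addContent_empty]

theorem exists_limit_measure (Ω : ℕ → Type*) [∀ n, Fintype (Ω n)] [∀ n, Nonempty (Ω n)] :
    ∃ μ : @Measure (∀ n, Ω n) (MeasurableSpace.generateFrom (range internal)),
      @IsProbabilityMeasure _ (MeasurableSpace.generateFrom (range internal)) μ ∧
      ∀ A : ∀ n, Set (Ω n), Filter.Tendsto (fun n => density (A n)) (Filter.hyperfilter ℕ)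
        (nhds (μ.real (internal A))) := by
  let _ : MeasurableSpace (∀ n, Ω n) := MeasurableSpace.generateFrom (range internal)
  have hR := (isSetAlgebra_range_internal (Ω := Ω)).isSetRing
  let μ := (limitContent Ω).measure hR.isSetSemiring le_rfl isSigmaSubadditive_limitContent
  have hμ : ∀ A : ∀ n, Set (Ω n), μ (internal A) = limitDensity (internal A) := fun A =>
    (limitContent Ω).measure_eq hR.isSetSemiring rfl isSigmaSubadditive_limitContent ⟨A, rfl⟩
  have hprob : IsProbabilityMeasure μ := ⟨by
    rw [← internal_univ, hμ, internal_univ, limitDensity_univ]⟩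
  refine ⟨μ, hprob, fun A => ?_⟩
  have h1 := (ENNReal.tendsto_toReal (measure_ne_top μ (internal A))).comp
    ((hμ A).symm ▸ tendsto_limitDensity A)
  refine h1.congr fun n => ?_
  exact ENNReal.toReal_ofReal (density_nonneg _)

end Internal

/-- A set of functions whose membership only depends on the values on `J`. -/
def IsCylinder {W V : Type*} (J : Finset W) (A : Set (W → V)) : Prop :=
  ∀ z z', (∀ i ∈ J, z i = z' i) → z ∈ A → z' ∈ A

namespace IsCylinder

variable {W V : Type*} {J K : Finset W} {A B : Set (W → V)}

theorem mem_iff (h : IsCylinder J A) {z z' : W → V} (hz : ∀ i ∈ J, z i = z' i) :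
    z ∈ A ↔ z' ∈ A :=
  ⟨h z z' hz, h z' z fun i hi => (hz i hi).symm⟩

theorem mono (h : IsCylinder J A) (hJK : J ⊆ K) : IsCylinder K A :=
  fun z z' hz => h z z' fun i hi => hz i (hJK hi)

theorem compl (h : IsCylinder J A) : IsCylinder J Aᶜ :=
  fun z z' hz hzA hz' => hzA (h z' z (fun i hi => (hz i hi).symm) hz')

theorem union (hA : IsCylinder J A) (hB : IsCylinder J B) : IsCylinder J (A ∪ B) :=
  fun z z' hz => Or.imp (hA z z' hz) (hB z z' hz)

theorem empty : IsCylinder J (∅ : Set (W → V)) := fun _ _ _ h => h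

theorem piecewise [DecidableEq W] (h : IsCylinder K A) (y : W → V) :
    IsCylinder (J ∩ K) {z | J.piecewise z y ∈ A} := by
  intro z z' hz
  refine h _ _ fun i hi => ?_
  by_cases hiJ : i ∈ J
  · simp [hiJ, hz i (Finset.mem_inter.2 ⟨hiJ, hi⟩)]
  · simp [hiJ]

end IsCylinder

theorem sum_sum_piecewise {W V : Type*} [Fintype W] [DecidableEq W] [Fintype V] (J : Finset W)
    (f : (W → V) → ℝ) :
    ∑ y, ∑ z, f (J.piecewise z y) = Fintype.card (W → V) * ∑ z, f z := by
  let T : (W → V) × (W → V) → (W → V) × (W → V) :=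
    fun q => (J.piecewise q.1 q.2, J.piecewise q.2 q.1)
  have hT : Function.Involutive T := by
    rintro ⟨z, y⟩
    refine Prod.ext (funext fun i => ?_) (funext fun i => ?_) <;>
      by_cases hi : i ∈ J <;> simp [T, hi]
  have h := Equiv.sum_comp hT.toPerm fun q => f q.1
  rw [Fintype.sum_prod_type_right, Fintype.sum_prod_type_right] at h
  simpa [T] using h

theorem exists_sum_le_sum_piecewise {W V : Type*} [Fintype W] [DecidableEq W] [Fintype V]
    [Nonempty V] (J : Finset W) {g : (W → V) → ℝ}
    (hg : ∀ z z', (∀ i ∈ J, z i = z' i) → g z = g z') (A : Set (W → V)) :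
    ∃ y, ∑ z, A.indicator g z ≤ ∑ z, {z | J.piecewise z y ∈ A}.indicator g z := by
  by_contra! hcon
  have h1 : ∑ y, ∑ z, {z | J.piecewise z y ∈ A}.indicator g z
      < ∑ _y : W → V, ∑ z, A.indicator g z :=
    Finset.sum_lt_sum_of_nonempty Finset.univ_nonempty fun y _ => hcon y
  have h2 : ∀ y z, {z | J.piecewise z y ∈ A}.indicator g z = A.indicator g (J.piecewise z y) := by
    intro y z
    have h3 : g z = g (J.piecewise z y) := hg _ _ fun i hi => by simp [hi]
    by_cases h : J.piecewise z y ∈ A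
    · simp [h, h3]
    · simp [h]
  simp only [h2, sum_sum_piecewise, Finset.sum_const, Finset.card_univ, nsmul_eq_mul] at h1
  exact lt_irrefl _ h1

theorem sum_mul_density_inter {α C : Type*} [Fintype α] [Fintype C] (v : C → ℝ) (D : C → Set α)
    (A : Set α) : ∑ c, v c * density (A ∩ D c) =
      (∑ z, A.indicator (fun z => ∑ c, (D c).indicator (fun _ => v c) z) z) / Fintype.card α := by
  classical
  have h1 : ∀ B : Set α, (B.ncard : ℝ) = ∑ z, B.indicator (fun _ => 1) z := by
    intro B
    rw [ncard_eq_toFinset_card', Finset.card_eq_sum_ones, Nat.cast_sum,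
      Finset.sum_indicator_eq_sum_filter]
    simp
  have h2 : ∀ z, A.indicator (fun z => ∑ c, (D c).indicator (fun _ => v c) z) z =
      ∑ c, v c * (A ∩ D c).indicator (fun _ => 1) z := by
    intro z
    by_cases hA : z ∈ A
    · simp only [hA, indicator_of_mem]
      refine Finset.sum_congr rfl fun c _ => ?_
      by_cases hD : z ∈ D c <;> simp [hA, hD]
    · simp [hA]
  simp only [h2, density, h1, mul_div_assoc']
  rw [Finset.sum_comm, ← Finset.sum_div]
  simp only [Finset.mul_sum]

theorem internal_biInter {ι : Type*} {Ω : ℕ → Type*} (t : Finset ι) (A : ι → ∀ n, Set (Ω n)) :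
    internal (fun n => ⋂ i ∈ t, A i n) = ⋂ i ∈ t, internal (A i) := by
  ext x
  simp only [mem_internal, mem_iInter, Filter.eventually_all_finset]

/-- The internal sets given by sequences of sets that only depend on the values on `J`. -/
def internalCylinders {W : Type*} (V : ℕ → Type*) (J : Finset W) :
    Set (Set (∀ n, W → V n)) :=
  {S | ∃ A : ∀ n, Set (W → V n), (∀ n, IsCylinder J (A n)) ∧ internal A = S}

section InternalCylinders

variable {W : Type} {V : ℕ → Type}

theorem isSetAlgebra_internalCylinders (J : Finset W) :
    IsSetAlgebra (internalCylinders V J) where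
  empty_mem := ⟨_, fun _ => IsCylinder.empty, internal_empty⟩
  compl_mem := by
    rintro _ ⟨A, hA, rfl⟩
    exact ⟨_, fun n => (hA n).compl, internal_compl.symm⟩
  union_mem := by
    rintro _ _ ⟨A, hA, rfl⟩ ⟨B, hB, rfl⟩
    exact ⟨_, fun n => (hA n).union (hB n), internal_union.symm⟩

theorem internalCylinders_mono : Monotone (internalCylinders (W := W) V) := by
  rintro J K hJK _ ⟨A, hA, rfl⟩
  exact ⟨A, fun n => (hA n).mono hJK, rfl⟩

theorem internalCylinders_subset (J : Finset W) : internalCylinders V J ⊆ range internal := by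
  rintro _ ⟨A, -, rfl⟩
  exact ⟨A, rfl⟩

/-- The σ-algebra generated by the internal cylinders over `J`. -/
abbrev cylinderSpace (V : ℕ → Type) (J : Finset W) : MeasurableSpace (∀ n, W → V n) :=
  MeasurableSpace.generateFrom (internalCylinders V J)

theorem cylinderSpace_mono : Monotone (cylinderSpace (W := W) V) := fun _ _ h =>
  MeasurableSpace.generateFrom_mono (internalCylinders_mono h)

theorem cylinderSpace_le (J : Finset W) :
    cylinderSpace V J ≤ MeasurableSpace.generateFrom (range internal) :=
  MeasurableSpace.generateFrom_mono (internalCylinders_subset J)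

variable [Fintype W] [DecidableEq W] [∀ n, Fintype (V n)]
  {m0 : MeasurableSpace (∀ n, W → V n)} (μ : Measure (∀ n, W → V n)) [IsProbabilityMeasure μ]

theorem tendsto_setIntegral (hm0 : MeasurableSpace.generateFrom (range internal) ≤ m0)
    (hμ : ∀ A : ∀ n, Set (W → V n), Filter.Tendsto (fun n => density (A n))
      (Filter.hyperfilter ℕ) (nhds (μ.real (internal A)))) {C : Type} [Fintype C]
    {γ : (∀ n, W → V n) → C} (v : C → ℝ) {D : C → ∀ n, Set (W → V n)}
    (hD : ∀ c, internal (D c) = γ ⁻¹' {c}) (A : ∀ n, Set (W → V n)) :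
    Filter.Tendsto (fun n => ∑ c, v c * density (A n ∩ D c n)) (Filter.hyperfilter ℕ)
      (nhds (∫ x in internal A, v (γ x) ∂μ)) := by
  have hm : ∀ A : ∀ n, Set (W → V n), MeasurableSet[m0] (internal A) := fun A =>
    hm0 _ (MeasurableSpace.measurableSet_generateFrom ⟨A, rfl⟩)
  have h1 : ∀ x, v (γ x) = ∑ c, (internal (D c)).indicator (fun _ => v c) x := by
    classical
    intro x
    simp only [hD, indicator_apply, mem_preimage, mem_singleton_iff]
    simp
  have h2 : ∫ x in internal A, v (γ x) ∂μ =
      ∑ c, v c * μ.real (internal fun n => A n ∩ D c n) := by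
    simp only [h1]
    have hi : ∀ c ∈ Finset.univ, Integrable ((internal (D c)).indicator fun _ => v c)
        (μ.restrict (internal A)) := fun c _ => (integrable_const (v c)).indicator (hm _)
    rw [integral_finsetSum _ hi]
    refine Finset.sum_congr rfl fun c _ => ?_
    rw [setIntegral_indicator (hm _), setIntegral_const, internal_inter, smul_eq_mul, mul_comm]
  rw [h2]
  exact tendsto_finsetSum _ fun c _ => (hμ _).const_mul _

variable [∀ n, Nonempty (V n)]

theorem exists_setIntegral_le (hm0 : MeasurableSpace.generateFrom (range internal) ≤ m0)
    (hμ : ∀ A : ∀ n, Set (W → V n), Filter.Tendsto (fun n => density (A n))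
      (Filter.hyperfilter ℕ) (nhds (μ.real (internal A)))) {C : Type} [Fintype C]
    {γ : (∀ n, W → V n) → C} (v : C → ℝ) {J : Finset W}
    (hγ : ∀ c, γ ⁻¹' {c} ∈ internalCylinders V J) (A : ∀ n, Set (W → V n)) :
    ∃ y : ∀ n, W → V n, ∫ x in internal A, v (γ x) ∂μ ≤
      ∫ x in internal fun n => {z | J.piecewise z (y n) ∈ A n}, v (γ x) ∂μ := by
  choose D hDJ hD using hγ
  have h := fun n => exists_sum_le_sum_piecewise J
    (g := fun z => ∑ c, (D c n).indicator (fun _ => v c) z) (fun z z' hz => by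
      classical
      refine Finset.sum_congr rfl fun c _ => ?_
      simp only [indicator_apply, (hDJ c n).mem_iff hz]) (A n)
  choose y hy using h
  refine ⟨y, le_of_tendsto_of_tendsto' (tendsto_setIntegral μ hm0 hμ v hD A)
    (tendsto_setIntegral μ hm0 hμ v hD _) fun n => ?_⟩
  rw [sum_mul_density_inter, sum_mul_density_inter]
  exact div_le_div_of_nonneg_right (hy n) (Nat.cast_nonneg _)

theorem cylinder_independence (hm0 : MeasurableSpace.generateFrom (range internal) ≤ m0)
    (hμ : ∀ A : ∀ n, Set (W → V n), Filter.Tendsto (fun n => density (A n))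
      (Filter.hyperfilter ℕ) (nhds (μ.real (internal A)))) (J : Finset W)
    (w : (∀ n, W → V n) → ℝ) (p : ℝ) (hw : Measurable[cylinderSpace V J] w)
    (hw1 : ∀ x, |w x| ≤ 1)
    (hwp : ∀ S, MeasurableSet[below (cylinderSpace V) J] S → ∫ x in S, w x ∂μ = p * μ.real S)
    (S : Set (∀ n, W → V n))
    (hS : MeasurableSet[⨆ J', ⨆ (_ : ¬ J ⊆ J'), cylinderSpace V J'] S) :
    ∫ x in S, w x ∂μ = p * μ.real S := by
  have hP : IsPiSystem (piiUnionInter (internalCylinders V) {J' : Finset W | ¬ J ⊆ J'}) :=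
    isPiSystem_piiUnionInter _ (fun J' s hs t ht _ =>
      (isSetAlgebra_internalCylinders J').inter_mem hs ht) _
  have hPm : MeasurableSpace.generateFrom
      (piiUnionInter (internalCylinders V) {J' : Finset W | ¬ J ⊆ J'}) ≤ m0 := by
    refine MeasurableSpace.generateFrom_le ?_
    rintro _ ⟨t, -, f, hf, rfl⟩
    refine Finset.measurableSet_biInter _ fun J' hJ' => ?_
    exact hm0 _ (MeasurableSpace.measurableSet_generateFrom
      (internalCylinders_subset J' (hf J' hJ')))
  refine setIntegral_eq_of_averaging μ (isSetAlgebra_internalCylinders J)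
    ((cylinderSpace_le J).trans hm0) hP hPm ?_ hw hw1 hwp (S := S) ?_
  · rintro _ ⟨t, ht, f, hf, rfl⟩ C _ γ v hγ
    have hf' : ∀ J', ∃ A : ∀ n, Set (W → V n), J' ∈ t →
        (∀ n, IsCylinder J' (A n)) ∧ internal A = f J' := by
      intro J'
      by_cases hJ' : J' ∈ t
      · obtain ⟨A, hA⟩ := hf J' hJ'
        exact ⟨A, fun _ => hA⟩
      · exact ⟨fun _ => ∅, fun h => absurd h hJ'⟩
    choose A hA using hf'
    have h1 : (⋂ J' ∈ t, f J') = internal fun n => ⋂ J' ∈ t, A J' n := by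
      rw [internal_biInter]
      exact iInter₂_congr fun J' hJ' => (hA J' hJ').2.symm
    rw [h1]
    obtain ⟨y, hy⟩ := exists_setIntegral_le μ hm0 hμ v hγ fun n => ⋂ J' ∈ t, A J' n
    refine ⟨_, ?_, hy⟩
    have h2 : (internal fun n => {z | J.piecewise z (y n) ∈ ⋂ J' ∈ t, A J' n}) =
        ⋂ J' ∈ t, internal fun n => {z | J.piecewise z (y n) ∈ A J' n} := by
      rw [← internal_biInter]
      congr 1
      funext n
      ext z
      simp
    rw [h2]
    refine @Finset.measurableSet_biInter _ _ (below (cylinderSpace V) J) _ _ fun J' hJ' => ?_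
    have h3 : J ∩ J' ⊂ J := by
      refine Finset.ssubset_iff_subset_ne.2 ⟨Finset.inter_subset_left, fun h => ?_⟩
      exact ht hJ' (Finset.inter_eq_left.1 h)
    refine (le_iSup₂_of_le (f := fun J' (_ : J' ⊂ J) => cylinderSpace V J') _ h3 le_rfl) _ ?_
    exact MeasurableSpace.measurableSet_generateFrom
      ⟨_, fun n => ((hA J' hJ').1 n).piecewise (y n), rfl⟩
  · refine (iSup₂_le fun J' hJ' => ?_ : (⨆ J', ⨆ (_ : ¬ J ⊆ J'), cylinderSpace V J') ≤ _) _ hS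
    exact MeasurableSpace.generateFrom_mono (subset_piiUnionInter (S := {J' | ¬ J ⊆ J'}) hJ')

end InternalCylinders

theorem exists_internal_coloring {W : Type} [Fintype W] [DecidableEq W] {V : ℕ → Type}
    {C : Type} [Fintype C] [Nonempty C] {γ : Finset W → (∀ n, W → V n) → C}
    (hγ : ∀ J c, γ J ⁻¹' {c} ∈ internalCylinders V J) :
    ∃ g : ∀ n, Finset W → (W → V n) → C,
      (∀ n J z z', (∀ i ∈ J, z i = z' i) → g n J z = g n J z') ∧
      ∀ x, ∀ᶠ n in (Filter.hyperfilter ℕ : Filter ℕ), ∀ J, g n J (x n) = γ J x := by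
  classical
  choose D hDJ hD using hγ
  refine ⟨fun n J z => if h : ∃ c, z ∈ D J c n then h.choose else Classical.arbitrary C, ?_, ?_⟩
  · intro n J z z' hz
    have h1 : (fun c => z ∈ D J c n) = fun c => z' ∈ D J c n :=
      funext fun c => propext ((hDJ J c n).mem_iff hz)
    simp only [h1]
  · intro x
    have h1 : ∀ J c, ∀ᶠ n in (Filter.hyperfilter ℕ : Filter ℕ),
        (x n ∈ D J c n ↔ γ J x = c) := by
      intro J c
      by_cases h : γ J x = c
      · have h2 : x ∈ internal (D J c) := by
          rw [hD]
          exact h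
        filter_upwards [mem_internal.1 h2] with n hn
        exact ⟨fun _ => h, fun _ => hn⟩
      · have h2 : x ∈ (internal (D J c))ᶜ := by
          rw [hD]
          exact h
        rw [internal_compl] at h2
        filter_upwards [mem_internal.1 h2] with n hn
        exact ⟨fun h => absurd h hn, fun h' => absurd h' h⟩
    have h2 : ∀ᶠ n in (Filter.hyperfilter ℕ : Filter ℕ), ∀ J c, (x n ∈ D J c n ↔ γ J x = c) := by
      simp only [Filter.eventually_all]
      exact h1
    filter_upwards [h2] with n hn J
    have h3 : ∃ c, x n ∈ D J c n := ⟨_, (hn J _).2 rfl⟩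
    rw [dif_pos h3]
    exact ((hn J _).1 h3.choose_spec).symm

theorem exists_good_internal_configurations {W : Type} [Fintype W] [DecidableEq W]
    {V : ℕ → Type} [∀ n, Fintype (V n)] [∀ n, Nonempty (V n)]
    {m0 : MeasurableSpace (∀ n, W → V n)} (μ : Measure (∀ n, W → V n)) [IsProbabilityMeasure μ]
    (hm0 : MeasurableSpace.generateFrom (range internal) ≤ m0)
    (hμ : ∀ A : ∀ n, Set (W → V n), Filter.Tendsto (fun n => density (A n))
      (Filter.hyperfilter ℕ) (nhds (μ.real (internal A))))
    (F : Finset (Finset W)) (E : Finset W → Set (∀ n, W → V n))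
    (hE : ∀ I ∈ F, E I ∈ internalCylinders V I) (hnull : μ (⋂ I ∈ F, E I) = 0) {ε : ℝ}
    (hε : 0 < ε) :
    ∃ (C : Type) (_ : Fintype C) (_ : Nonempty C) (γ : Finset W → (∀ n, W → V n) → C)
      (Good : Finset W → Set (Finset W → C)),
      (∀ J c, γ J ⁻¹' {c} ∈ internalCylinders V J) ∧
      (∀ I c c', (∀ J ⊆ I, c J = c' J) → c ∈ Good I → c' ∈ Good I) ∧
      (∀ c, ∃ I ∈ F, c ∉ Good I) ∧
      ∀ I ∈ F, μ.real (E I ∩ {x | (fun J => γ J x) ∉ Good I}) ≤ ε := by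
  have hB : ∀ J, cylinderSpace V J ≤ m0 := fun J => (cylinderSpace_le J).trans hm0
  obtain ⟨C, hC, hC', γ, Good, hγ, hGood, hcov, hsmall⟩ := exists_good_configurations μ
    (cylinderSpace V) hB cylinderSpace_mono (cylinder_independence μ hm0 hμ) F E
    (fun I hI => MeasurableSpace.measurableSet_generateFrom (hE I hI)) hnull (half_pos hε)
  let N : ℝ := Fintype.card (Finset W)
  have hN : 0 < N := by
    simp only [N]
    exact_mod_cast Fintype.card_pos
  have happ := fun J => exists_fiber_mem_algebra_approx μ (isSetAlgebra_internalCylinders J)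
    (hB J) (hγ J) (ε := ε / 2 / N) (by positivity)
  choose γ' hγ' hdist using happ
  refine ⟨C, hC, hC', γ', Good, hγ', hGood, hcov, fun I hI => ?_⟩
  calc μ.real (E I ∩ {x | (fun J => γ' J x) ∉ Good I})
      ≤ μ.real ((E I ∩ {x | (fun J => γ J x) ∉ Good I}) ∪ ⋃ J, {x | γ J x ≠ γ' J x}) := by
        refine measureReal_mono ?_
        rintro x ⟨hxE, hx⟩
        by_cases h : ∀ J, γ J x = γ' J x
        · left
          refine ⟨hxE, ?_⟩
          simpa only [mem_ofPred_eq, h] using hx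
        · right
          push Not at h
          exact mem_iUnion.2 h
    _ ≤ μ.real (E I ∩ {x | (fun J => γ J x) ∉ Good I}) +
          ∑ J, μ.real {x | γ J x ≠ γ' J x} :=
        (measureReal_union_le _ _).trans
          (add_le_add_right (measureReal_iUnion_fintype_le _) _)
    _ ≤ ε / 2 + ∑ _J : Finset W, ε / 2 / N :=
        add_le_add (hsmall I hI) (Finset.sum_le_sum fun J _ => hdist J)
    _ = ε := by
        rw [Finset.sum_const, Finset.card_univ, nsmul_eq_mul]
        change ε / 2 + N * (ε / 2 / N) = ε
        field_simp
        ring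

/-- Removal for sequences of cylinders whose intersections have vanishing density. -/
theorem exists_cylinder_removal {W : Type} [Fintype W] [DecidableEq W]
    {V : ℕ → Type} [∀ n, Fintype (V n)] [∀ n, Nonempty (V n)]
    (F : Finset (Finset W)) (E : Finset W → ∀ n, Set (W → V n))
    (hE : ∀ I ∈ F, ∀ n, IsCylinder I (E I n))
    (hlim : Filter.Tendsto (fun n => density (⋂ I ∈ F, E I n)) Filter.atTop (nhds 0)) {ε : ℝ}
    (hε : 0 < ε) :
    ∃ n, ∃ E' : Finset W → Set (W → V n), (∀ I ∈ F, IsCylinder I (E' I)) ∧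
      (∀ z, ∃ I ∈ F, z ∉ E' I) ∧ ∀ I ∈ F, density (E I n \ E' I) ≤ ε := by
  let m0 : MeasurableSpace (∀ n, W → V n) := MeasurableSpace.generateFrom (range internal)
  obtain ⟨μ, hprob, hμ⟩ := exists_limit_measure fun n => W → V n
  have hnull : μ (⋂ I ∈ F, internal (E I)) = 0 := by
    rw [← internal_biInter, ← measureReal_eq_zero_iff]
    exact tendsto_nhds_unique (hμ _) (hlim.mono_left Nat.hyperfilter_le_atTop)
  obtain ⟨C, _, _, γ, Good, hγ, hGood, hcov, hsmall⟩ := exists_good_internal_configurations μ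
    le_rfl hμ F (fun I => internal (E I)) (fun I hI => ⟨_, hE I hI, rfl⟩) hnull (half_pos hε)
  obtain ⟨g, hg, hgγ⟩ := exists_internal_coloring hγ
  let E' : Finset W → ∀ n, Set (W → V n) := fun I n =>
    {z | z ∈ E I n ∧ (fun J => g n J z) ∈ Good I}
  have hev : ∀ I ∈ F, ∀ᶠ n in (Filter.hyperfilter ℕ : Filter ℕ),
      density (E I n \ E' I n) < ε := by
    intro I hI
    refine (hμ fun n => E I n \ E' I n).eventually_lt_const (lt_of_le_of_lt ?_ (half_lt_self hε))
    refine (measureReal_mono ?_).trans (hsmall I hI)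
    intro x hx
    have hx' := mem_internal.1 hx
    refine ⟨hx'.mono fun n hn => hn.1, ?_⟩
    obtain ⟨n, hn, hn'⟩ := (hx'.and (hgγ x)).exists
    intro hxG
    refine hn.2 ⟨hn.1, ?_⟩
    simpa only [hn'] using hxG
  rw [← Filter.eventually_all_finset] at hev
  obtain ⟨n, hn⟩ := hev.exists
  refine ⟨n, fun I => E' I n, ?_, ?_, fun I hI => (hn I hI).le⟩
  · intro I hI z z' hz hzE
    refine ⟨hE I hI n z z' hz hzE.1, hGood I _ _ (fun J hJ => ?_) hzE.2⟩
    exact hg n J z z' fun i hi => hz i (hJ hi)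
  · intro z
    obtain ⟨I, hI, hc⟩ := hcov fun J => g n J z
    exact ⟨I, hI, fun h => hc h.2⟩

theorem ncard_image_mul_le {W V : Type*} [Fintype W] [DecidableEq W] [Fintype V] [DecidableEq V]
    {I : Finset W} {A : Set (W → V)} (hA : IsCylinder I A) :
    (Set.image (fun z => I.image z) A).ncard * Fintype.card V ^ (Fintype.card W - I.card) ≤ A.ncard := by
  classical
  let f : (Set.image (fun z => I.image z) A) × ({i // i ∉ I} → V) → A := fun q =>
    ⟨fun i => if h : i ∈ I then q.1.2.choose i else q.2 ⟨i, h⟩,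
      hA _ _ (fun i hi => by simp [hi]) q.1.2.choose_spec.1⟩
  have hf : Function.Injective f := by
    rintro ⟨a, b⟩ ⟨a', b'⟩ h
    have h1 := fun i => congrFun (Subtype.ext_iff.1 h) i
    refine Prod.ext (Subtype.ext ?_) (funext fun i => ?_)
    · rw [← a.2.choose_spec.2, ← a'.2.choose_spec.2]
      refine Finset.image_congr fun i hi => ?_
      have hi' : i ∈ I := hi
      simpa [f, hi'] using h1 i
    · simpa [f, i.2] using h1 i
  have h := Nat.card_le_card_of_injective f hf
  rw [Nat.card_prod, Nat.card_coe_set_eq, Nat.card_coe_set_eq] at h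
  refine le_of_eq_of_le ?_ h
  congr 1
  rw [Nat.card_eq_fintype_card, Fintype.card_fun, Fintype.card_subtype_compl,
    Fintype.card_coe]

theorem ncard_image_le {W V : Type*} [Fintype W] [DecidableEq W] [Fintype V] [DecidableEq V]
    [Nonempty V] {I : Finset W} {A : Set (W → V)} (hA : IsCylinder I A) {ε : ℝ}
    (h : density A ≤ ε) :
    ((Set.image (fun z => I.image z) A).ncard : ℝ) ≤ ε * (Fintype.card V : ℝ) ^ I.card := by
  have hV : (0 : ℝ) < Fintype.card V := by exact_mod_cast Fintype.card_pos
  have h1 : ((Set.image (fun z => I.image z) A).ncard : ℝ) *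
      (Fintype.card V : ℝ) ^ (Fintype.card W - I.card) ≤ A.ncard := by
    exact_mod_cast ncard_image_mul_le hA
  have h2 : (A.ncard : ℝ) ≤ ε * (Fintype.card V : ℝ) ^ Fintype.card W := by
    rw [density, Fintype.card_fun, Nat.cast_pow, div_le_iff₀ (by positivity)] at h
    exact h
  rw [← Nat.sub_add_cancel (Finset.card_le_univ I), pow_add] at h2
  refine le_of_mul_le_mul_right (a := (Fintype.card V : ℝ) ^ (Fintype.card W - I.card)) ?_
    (by positivity)
  linarith

end

/-- The functions embedding `I` onto an edge of `E`. -/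
def edgeSet {W V : Type*} [DecidableEq V] (E : Finset (Finset V)) (I : Finset W) :
    Set (W → V) :=
  {z | Set.InjOn z ↑I ∧ Finset.image z I ∈ E}

theorem isCylinder_edgeSet {W V : Type*} [DecidableEq V] (E : Finset (Finset V))
    (I : Finset W) : IsCylinder I (edgeSet E I) := by
  rintro z z' hz ⟨h1, h2⟩
  have h3 : Set.EqOn z z' ↑I := fun i hi => hz i hi
  exact ⟨h1.congr h3, by rwa [← Finset.image_congr h3]⟩

theorem copyCount_eq_ncard {W V : Type} [Fintype W] [Fintype V] [DecidableEq V]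
    (F : Finset (Finset W)) (E : Finset (Finset V)) :
    copyCount W V F E = (⋂ I ∈ F, edgeSet E I).ncard := by
  rw [copyCount, ← Nat.card_coe_set_eq]
  refine Nat.card_congr (Equiv.subtypeEquivRight fun φ => ?_)
  simp [edgeSet]

theorem exists_removal_of_cylinders {W V : Type} [Fintype W] [DecidableEq W] [Fintype V]
    [DecidableEq V] [Nonempty V] {k : ℕ} {F : Finset (Finset W)} (hF : ∀ I ∈ F, I.card = k)
    (E : Finset (Finset V)) (A : Finset W → Set (W → V)) (hA : ∀ I ∈ F, IsCylinder I (A I))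
    (hcov : ∀ z, ∃ I ∈ F, z ∉ A I) {ε : ℝ} (hε : 0 ≤ ε)
    (hsmall : ∀ I ∈ F, density (edgeSet E I \ A I) ≤ ε / (F.card + 1)) :
    ∃ E' ⊆ E, ((E \ E').card : ℝ) ≤ ε * (Fintype.card V : ℝ) ^ k ∧ copyCount W V F E' = 0 := by
  classical
  let bad : Finset W → Set (Finset V) := fun I =>
    Set.image (fun z => I.image z) (edgeSet E I \ A I)
  refine ⟨E.filter fun e => ∀ I ∈ F, e ∉ bad I, Finset.filter_subset _ _, ?_, ?_⟩
  · have hbad : ∀ I ∈ F, ((bad I).ncard : ℝ) ≤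
        ε / (F.card + 1) * (Fintype.card V : ℝ) ^ k := by
      intro I hI
      rw [← hF I hI]
      have hcyl := ((isCylinder_edgeSet E I).compl.union (hA I hI)).compl
      rw [Set.compl_union, compl_compl] at hcyl
      exact ncard_image_le hcyl (hsmall I hI)
    have hsub : E \ E.filter (fun e => ∀ I ∈ F, e ∉ bad I) ⊆
        F.biUnion fun I => (bad I).toFinset := by
      intro e he
      simp only [Finset.mem_sdiff, Finset.mem_filter, not_and] at he
      have h := he.2 he.1
      push Not at h
      obtain ⟨I, hI, heI⟩ := h
      exact Finset.mem_biUnion.2 ⟨I, hI, Set.mem_toFinset.2 heI⟩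
    calc _ ≤ ((F.biUnion fun I => (bad I).toFinset).card : ℝ) := by
          exact_mod_cast Finset.card_le_card hsub
      _ ≤ ∑ I ∈ F, ((bad I).ncard : ℝ) := by
          simp only [Set.ncard_eq_toFinset_card']
          exact_mod_cast Finset.card_biUnion_le
      _ ≤ ∑ _I ∈ F, ε / (F.card + 1) * (Fintype.card V : ℝ) ^ k := Finset.sum_le_sum hbad
      _ = F.card / (F.card + 1) * (ε * (Fintype.card V : ℝ) ^ k) := by
          rw [Finset.sum_const, nsmul_eq_mul]
          ring
      _ ≤ 1 * (ε * (Fintype.card V : ℝ) ^ k) := by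
          gcongr
          exact div_le_one_of_le₀ (by linarith) (by positivity)
      _ = _ := one_mul _
  · rw [copyCount_eq_ncard, Set.ncard_eq_zero (Set.toFinite _), Set.eq_empty_iff_forall_notMem]
    intro z hz
    simp only [Set.mem_iInter] at hz
    obtain ⟨I, hI, hzI⟩ := hcov z
    obtain ⟨h1, h2⟩ := hz I hI
    rw [Finset.mem_filter] at h2
    exact h2.2 I hI ⟨z, ⟨⟨h1, h2.1⟩, hzI⟩, rfl⟩

end HypergraphRemoval

/-- The hypergraph removal lemma. -/
theorem hypergraph_removal (ε : ℝ) (hε : 0 < ε) (k : ℕ) (hk : 0 < k)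
    (W : Type) [Fintype W] (F : Finset (Finset W)) (hF : ∀ I ∈ F, I.card = k) :
    ∃ δ : ℝ, 0 < δ ∧
      ∀ (V : Type) [Fintype V] [DecidableEq V] (E : Finset (Finset V)),
        (∀ e ∈ E, e.card = k) →
        ((copyCount W V F E : ℝ) ≤ δ * (Fintype.card V : ℝ) ^ (Fintype.card W)) →
        ∃ E' ⊆ E, ((E \ E').card : ℝ) ≤ ε * (Fintype.card V : ℝ) ^ k ∧
          copyCount W V F E' = 0 := by
  classical
  by_contra hcon
  push Not at hcon
  choose V fV dV E hE hcopy hbad using fun n : ℕ =>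
    hcon (1 / ((n : ℝ) + 2)) (by positivity)
  have hpos : ∀ n, 0 < copyCount W (V n) F (E n) := by
    intro n
    refine Nat.pos_of_ne_zero fun h => ?_
    refine hbad n (E n) subset_rfl ?_ h
    simp only [sdiff_self, Finset.bot_eq_empty, Finset.card_empty, Nat.cast_zero]
    positivity
  have hne : ∀ n, Nonempty (V n) := by
    intro n
    by_contra hV
    rw [not_nonempty_iff] at hV
    obtain ⟨φ, -⟩ := (Nat.card_pos_iff.1 (hpos n)).1
    have hW : IsEmpty W := ⟨fun i => hV.elim (φ i)⟩
    have h1 : (1 : ℝ) ≤ copyCount W (V n) F (E n) := by exact_mod_cast hpos n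
    have h2 := h1.trans (hcopy n)
    rw [Fintype.card_eq_zero (α := W), pow_zero, mul_one, le_div_iff₀ (by positivity)] at h2
    have h3 : (0 : ℝ) ≤ n := Nat.cast_nonneg n
    linarith
  have hlim : Filter.Tendsto (fun n => HypergraphRemoval.density
      (⋂ I ∈ F, HypergraphRemoval.edgeSet (E n) I)) Filter.atTop (nhds 0) := by
    refine squeeze_zero (fun n => HypergraphRemoval.density_nonneg _) (fun n => ?_)
      tendsto_one_div_add_atTop_nhds_zero_nat
    have hV : (0 : ℝ) < Fintype.card (V n) := by exact_mod_cast Fintype.card_pos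
    rw [HypergraphRemoval.density, ← HypergraphRemoval.copyCount_eq_ncard, Fintype.card_fun,
      Nat.cast_pow, div_le_iff₀ (by positivity)]
    refine (hcopy n).trans ?_
    gcongr
    norm_num
  obtain ⟨n, A, hA, hcov, hsmall⟩ := HypergraphRemoval.exists_cylinder_removal F
    (fun I n => HypergraphRemoval.edgeSet (E n) I)
    (fun I _ n => HypergraphRemoval.isCylinder_edgeSet (E n) I) hlim
    (ε := ε / (F.card + 1)) (by positivity)
  obtain ⟨E', hE', hcard, hzero⟩ :=
    HypergraphRemoval.exists_removal_of_cylinders hF (E n) A hA hcov hε.le hsmall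
  exact hbad n E' hE' hcard hzero
end
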